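/- Let f be integrable on the unit ball B³ ⊂ ℝ³ and N ≥ 2. Define σ_N = Σ (2n+4k+1)^{−1} (∫_{B³} f(x) B_{k,l}^{−1,n}(x) dx) B_{k,l}^{−1,n}, where the sum runs over all triples (k, n, l) with k ≥ 1, 2k+n ≤ N and 1 ≤ l ≤ 2n+1. Then σ_N solves the discrete Galerkin problem: ∫_{B³} ∇σ_N(x) · ∇v_N(x) dx = ∫_{B³} f(x) v_N(x) dx for every v_N in the linear span V_N of {B_{k,l}^{−1,n} : k ≥ 1, 2 ≤ 2k+n ≤ N, 1 ≤ l ≤ 2n+1}. -/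

import Mathlib

open MeasureTheory Real
open scoped RealInnerProductSpace

noncomputable section

/-- Jacobi polynomial `P_n^{α,β}(t)`. -/
def jacobiP (n : ℕ) (α β : ℝ) (t : ℝ) : ℝ :=
  (Real.Gamma (α + n + 1) / (n.factorial * Real.Gamma (α + β + n + 1))) *
    ∑ m ∈ Finset.range (n + 1), (n.choose m : ℝ) *
      (Real.Gamma (α + β + n + m + 1) / Real.Gamma (α + m + 1)) * ((t - 1) / 2) ^ m

/-- Normalization constant `C_{n,j}` of spherical harmonics. -/
def sphC (n j : ℕ) : ℝ :=
  (1 / 2 ^ j) * Real.sqrt ((2 * n + 1) * Real.Gamma ((n : ℝ) - j + 1) *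
    Real.Gamma ((n : ℝ) + j + 1) / (2 * Real.pi * Real.Gamma ((n : ℝ) + 1) ^ 2))

/-- Spherical harmonic `Y_l^n(θ, φ)`; for `l = 2j` the cosine type, for `l = 2j+1 ≥ 3`
the sine type (in both cases `j = l / 2` by natural division). -/
def sphY (n l : ℕ) (θ φ : ℝ) : ℝ :=
  if l = 1 then Real.sqrt ((2 * n + 1) / (4 * Real.pi)) * jacobiP n 0 0 (Real.cos θ)
  else if l % 2 = 0 then
    sphC n (l / 2) * Real.sin θ ^ (l / 2) * Real.cos ((l / 2 : ℕ) * φ) *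
      jacobiP (n - l / 2) (l / 2 : ℕ) (l / 2 : ℕ) (Real.cos θ)
  else
    sphC n (l / 2) * Real.sin θ ^ (l / 2) * Real.sin ((l / 2 : ℕ) * φ) *
      jacobiP (n - l / 2) (l / 2 : ℕ) (l / 2 : ℕ) (Real.cos θ)

abbrev E3 := EuclideanSpace ℝ (Fin 3)

/-- Pochhammer symbol `(a)_k = Γ(a+k)/Γ(a)`. -/
def poch (a : ℝ) (k : ℕ) : ℝ := Real.Gamma (a + k) / Real.Gamma a

/-- The solid spherical harmonic `‖x‖^n Y_l^n(x/‖x‖)`, written using the polar angles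
`θ = arccos(x₃/‖x‖)` and the azimuthal angle `φ = arg(x₁ + i x₂)` of `x/‖x‖`. -/
def solidY (n l : ℕ) (x : E3) : ℝ :=
  ‖x‖ ^ n * sphY n l (Real.arccos (‖x‖⁻¹ * x 2)) (Complex.arg (x 0 + x 1 * Complex.I))

/-- Ball polynomial `B_{k,l}^{α,n}(x)`. -/
def ballB (α : ℝ) (k n l : ℕ) (x : E3) : ℝ :=
  (poch ((n : ℝ) + k + 3 / 2) k / poch ((n : ℝ) + k + α + 3 / 2) k) *
    jacobiP k α ((n : ℝ) + 1 / 2) (2 * ‖x‖ ^ 2 - 1) * solidY n l x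

/-- Normalization constant `h_k^{α,n}`. -/
def hNorm (α : ℝ) (k n : ℕ) : ℝ :=
  Real.Gamma ((k : ℝ) + α + 1) * Real.Gamma ((n : ℝ) + 2 * k + 3 / 2) *
      poch ((n : ℝ) + k + 3 / 2) k /
    (2 * Real.Gamma ((k : ℝ) + 1) * Real.Gamma ((n : ℝ) + 2 * k + α + 5 / 2) *
      poch ((n : ℝ) + k + α + 3 / 2) k)

/-- Generalized ball polynomial `B_{k,l}^{-1,n}`. -/
def genBallB (k n l : ℕ) (x : E3) : ℝ :=
  if k = 0 then ballB 0 0 n l x else ballB 0 k n l x - ballB 0 (k - 1) n l x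

/-- The truncated expansion `σ_N` of the Galerkin solution: the sum over all triples
`(k, n, l)` with `k ≥ 1`, `2k + n ≤ N`, `1 ≤ l ≤ 2n+1` of
`(2n+4k+1)⁻¹ (∫_{B³} f B_{k,l}^{-1,n}) B_{k,l}^{-1,n}`. -/
def sigmaN (f : E3 → ℝ) (N : ℕ) (x : E3) : ℝ :=
  ∑ k ∈ Finset.Icc 1 N, ∑ n ∈ Finset.range (N + 1), ∑ l ∈ Finset.Icc 1 (2 * n + 1),
    if 2 * k + n ≤ N then
      (2 * (n : ℝ) + 4 * k + 1)⁻¹ *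
        (∫ y in Metric.closedBall (0 : E3) 1, f y * genBallB k n l y) * genBallB k n l x
    else 0

/-- The approximation space `V_N`, spanned by the generalized ball polynomials
`B_{k,l}^{-1,n}` with `k ≥ 1`, `2 ≤ 2k + n ≤ N`, `1 ≤ l ≤ 2n+1`. -/
def VN (N : ℕ) : Submodule ℝ (E3 → ℝ) :=
  Submodule.span ℝ {g : E3 → ℝ | ∃ k n l : ℕ, 1 ≤ k ∧ 2 ≤ 2 * k + n ∧ 2 * k + n ≤ N ∧
    1 ≤ l ∧ l ≤ 2 * n + 1 ∧ g = genBallB k n l}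

end

/-- The Jacobi polynomial as a formal polynomial in the variable `(t - 1) / 2`. -/
noncomputable def jacobiPoly (n : ℕ) (α β : ℝ) : Polynomial ℝ :=
  ∑ m ∈ Finset.range (n + 1), Polynomial.monomial m
    ((Real.Gamma (α + n + 1) / (n.factorial * Real.Gamma (α + β + n + 1))) * ((n.choose m : ℝ) *
      (Real.Gamma (α + β + n + m + 1) / Real.Gamma (α + m + 1))))

lemma jacobiP_eq_eval (n : ℕ) (α β t : ℝ) :
    jacobiP n α β t = (jacobiPoly n α β).eval ((t - 1) / 2) := by
  simp [jacobiP, jacobiPoly, Polynomial.eval_finsetSum, Finset.mul_sum, mul_assoc]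

lemma coeff_jacobiPoly (n : ℕ) (α β : ℝ) (m : ℕ) :
    (jacobiPoly n α β).coeff m =
      (Real.Gamma (α + n + 1) / (n.factorial * Real.Gamma (α + β + n + 1))) * ((n.choose m : ℝ) *
        (Real.Gamma (α + β + n + m + 1) / Real.Gamma (α + m + 1))) := by
  simp only [jacobiPoly, Polynomial.finsetSum_coeff, Polynomial.coeff_monomial]
  rw [Finset.sum_ite_eq' (Finset.range (n + 1)) m]
  split_ifs with h
  · rfl
  · rw [Nat.choose_eq_zero_of_lt (by simpa using h)]; simp

lemma jacobiPoly_zero {α β : ℝ} (hα : 0 ≤ α) (hβ : 0 ≤ β) : jacobiPoly 0 α β = 1 := by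
  have h1 : Real.Gamma (α + 1) ≠ 0 := (Real.Gamma_pos_of_pos (by linarith)).ne'
  have h2 : Real.Gamma (α + β + 1) ≠ 0 := (Real.Gamma_pos_of_pos (by linarith)).ne'
  have h3 : Real.Gamma (α + 1) / Real.Gamma (α + β + 1) *
    (Real.Gamma (α + β + 1) / Real.Gamma (α + 1)) = 1 := by field_simp
  simp [jacobiPoly, h3]

/-- At `t = 1` the Jacobi polynomials with `α = 0` equal one. -/
lemma jacobiPoly_eval_zero (n : ℕ) {β : ℝ} (hβ : 0 ≤ β) : (jacobiPoly n 0 β).eval 0 = 1 := by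
  rw [← Polynomial.coeff_zero_eq_eval_zero, coeff_jacobiPoly]
  have h2 : Real.Gamma (β + n + 1) ≠ 0 := (Real.Gamma_pos_of_pos (by positivity)).ne'
  simp [Real.Gamma_nat_eq_factorial]
  field_simp

lemma derivative_jacobiPoly (n : ℕ) {α β : ℝ} (hα : 0 ≤ α) (hβ : 0 ≤ β) :
    (jacobiPoly (n + 1) α β).derivative =
      Polynomial.C (α + β + n + 2) * jacobiPoly n (α + 1) (β + 1) := by
  ext m
  rw [Polynomial.coeff_derivative, Polynomial.coeff_C_mul, coeff_jacobiPoly, coeff_jacobiPoly]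
  have hc := Nat.add_one_mul_choose_eq n m
  have hc' : ((n : ℝ) + 1) * n.choose m = (n + 1).choose (m + 1) * (m + 1) := by exact_mod_cast hc
  have e1 : Real.Gamma (α + β + n + 3) = (α + β + n + 2) * Real.Gamma (α + β + n + 2) := by
    rw [← Real.Gamma_add_one (by positivity)]; ring_nf
  have p1 : Real.Gamma (α + β + n + 2) ≠ 0 := (Real.Gamma_pos_of_pos (by positivity)).ne'
  have p2 : Real.Gamma (α + m + 2) ≠ 0 := (Real.Gamma_pos_of_pos (by positivity)).ne'
  have p3 : α + β + n + 2 ≠ 0 := by positivity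
  push_cast [Nat.factorial_succ]
  rw [show α + 1 + (β + 1) + n + 1 = α + β + n + 3 by ring, e1,
    show α + β + ((n : ℝ) + 1) + 1 = α + β + n + 2 by ring,
    show α + β + ((n : ℝ) + 1) + (m + 1) + 1 = α + β + n + m + 3 by ring,
    show α + 1 + (β + 1) + n + m + 1 = α + β + n + m + 3 by ring,
    show α + ((m : ℝ) + 1) + 1 = α + m + 2 by ring,
    show α + 1 + (m : ℝ) + 1 = α + m + 2 by ring,
    show α + 1 + (n : ℝ) + 1 = α + (n + 1) + 1 by ring]
  field_simp
  linear_combination (-1 : ℝ) * hc'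

/-- The lowering relation dual to `derivative_jacobiPoly`. -/
lemma jacobiPoly_rodrigues (n : ℕ) {α β : ℝ} (hα : 0 ≤ α) (hβ : 0 ≤ β) :
    Polynomial.X * (1 + Polynomial.X) * (jacobiPoly n (α + 1) (β + 1)).derivative +
      (Polynomial.C (α + 1) + Polynomial.C (α + β + 2) * Polynomial.X) *
        jacobiPoly n (α + 1) (β + 1) =
      Polynomial.C ((n : ℝ) + 1) * jacobiPoly (n + 1) α β := by
  have key : ∀ m : ℕ, (m + α + 1) * (jacobiPoly n (α + 1) (β + 1)).coeff m +
      (m + α + β + 1) * (if m = 0 then 0 else (jacobiPoly n (α + 1) (β + 1)).coeff (m - 1)) =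
      (n + 1) * (jacobiPoly (n + 1) α β).coeff m := by
    intro m
    have e1 : Real.Gamma (α + β + n + 3) = (α + β + n + 2) * Real.Gamma (α + β + n + 2) := by
      rw [← Real.Gamma_add_one (by positivity)]; ring_nf
    have e2 : Real.Gamma (α + m + 2) = (α + m + 1) * Real.Gamma (α + m + 1) := by
      rw [← Real.Gamma_add_one (by positivity)]; ring_nf
    have e3 : Real.Gamma (α + β + n + m + 3) =
        (α + β + n + m + 2) * Real.Gamma (α + β + n + m + 2) := by
      rw [← Real.Gamma_add_one (by positivity)]; ring_nf
    have p1 : Real.Gamma (α + β + n + 2) ≠ 0 := (Real.Gamma_pos_of_pos (by positivity)).ne'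
    have p2 : Real.Gamma (α + m + 1) ≠ 0 := (Real.Gamma_pos_of_pos (by positivity)).ne'
    have p3 : α + β + n + 2 ≠ 0 := by positivity
    have p4 : α + m + 1 ≠ 0 := by positivity
    rcases m with _ | m
    · simp only [coeff_jacobiPoly]
      push_cast [Nat.factorial_succ] at *
      rw [show α + 1 + (β + 1) + n + 1 = α + β + n + 3 by ring, e1,
        show α + β + ((n : ℝ) + 1) + 1 = α + β + n + 2 by ring,
        show α + β + ((n : ℝ) + 1) + 0 + 1 = α + β + n + 0 + 2 by ring,
        show α + 1 + (β + 1) + n + 0 + 1 = α + β + n + 0 + 3 by ring, e3,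
        show α + 1 + (0 : ℝ) + 1 = α + 0 + 2 by ring, e2,
        show α + 1 + (n : ℝ) + 1 = α + (n + 1) + 1 by ring]
      simp only [Nat.choose_zero_right]
      field_simp
      push_cast
      ring
    · simp only [coeff_jacobiPoly]
      have hc : (n + 1).choose (m + 1) = n.choose m + n.choose (m + 1) := Nat.choose_succ_succ n m
      have hd := Nat.add_one_mul_choose_eq n m
      have hd' : ((n : ℝ) + 1) * n.choose m = (n + 1).choose (m + 1) * (m + 1) := by
        exact_mod_cast hd
      have hc' : ((n + 1).choose (m + 1) : ℝ) = n.choose m + n.choose (m + 1) := by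
        exact_mod_cast hc
      push_cast [Nat.factorial_succ] at *
      rw [show α + 1 + (β + 1) + n + 1 = α + β + n + 3 by ring, e1,
        show α + β + ((n : ℝ) + 1) + 1 = α + β + n + 2 by ring,
        show α + β + ((n : ℝ) + 1) + (m + 1) + 1 = α + β + n + (m + 1) + 2 by ring,
        show α + 1 + (β + 1) + n + (m + 1) + 1 = α + β + n + (m + 1) + 3 by ring, e3,
        show α + 1 + (β + 1) + n + m + 1 = α + β + n + (m + 1) + 2 by ring,
        show α + 1 + ((m : ℝ) + 1) + 1 = α + (m + 1) + 2 by ring, e2,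
        show α + 1 + (m : ℝ) + 1 = α + (m + 1) + 1 by ring,
        show α + 1 + (n : ℝ) + 1 = α + (n + 1) + 1 by ring]
      have p5 : (n : ℝ) + 1 ≠ 0 := by positivity
      have hf : (n.factorial : ℝ) ≠ 0 := by positivity
      rw [hc'] at hd' ⊢
      field_simp
      linear_combination (-(α + m + 2)) * hd'
  ext m
  have hk := key m
  have h1 : Polynomial.X * (1 + Polynomial.X) * (jacobiPoly n (α + 1) (β + 1)).derivative +
      (Polynomial.C (α + 1) + Polynomial.C (α + β + 2) * Polynomial.X) *
        jacobiPoly n (α + 1) (β + 1) =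
      Polynomial.X * ((jacobiPoly n (α + 1) (β + 1)).derivative +
        Polynomial.X * (jacobiPoly n (α + 1) (β + 1)).derivative +
        Polynomial.C (α + β + 2) * jacobiPoly n (α + 1) (β + 1)) +
      Polynomial.C (α + 1) * jacobiPoly n (α + 1) (β + 1) := by ring
  rw [h1, Polynomial.coeff_C_mul, ← hk]
  rcases m with _ | m
  · simp
  · rw [Polynomial.coeff_add, Polynomial.coeff_X_mul]
    rcases m with _ | m
    · simp only [Polynomial.coeff_add, Polynomial.coeff_C_mul, Polynomial.coeff_derivative,
        Polynomial.coeff_X_mul_zero]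
      simp
      ring
    · simp only [Polynomial.coeff_add, Polynomial.coeff_C_mul, Polynomial.coeff_derivative,
        Polynomial.coeff_X_mul]
      simp
      ring

lemma derivative_jacobiPoly_sub (k : ℕ) {β : ℝ} (hβ : 0 ≤ β) :
    (jacobiPoly (k + 1) 0 β - jacobiPoly k 0 β).derivative =
      Polynomial.C (2 * k + β + 2) * jacobiPoly k 0 (β + 1) := by
  ext m
  rw [Polynomial.coeff_derivative, Polynomial.coeff_C_mul, Polynomial.coeff_sub]
  simp only [coeff_jacobiPoly]
  have hc' : ((k + 1).choose (m + 1) : ℝ) = k.choose m + k.choose (m + 1) := by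
    exact_mod_cast Nat.choose_succ_succ k m
  have hd' : (k.choose (m + 1) : ℝ) * (m + 1) = k.choose m * (k - m) := by
    rcases le_or_gt m k with h | h
    · have := Nat.choose_succ_right_eq k m
      rw [← Nat.cast_sub h]
      exact_mod_cast this
    · simp [Nat.choose_eq_zero_of_lt h, Nat.choose_eq_zero_of_lt (Nat.lt_succ_of_lt h)]
  have e1 : Real.Gamma (β + k + 2) = (β + k + 1) * Real.Gamma (β + k + 1) := by
    rw [← Real.Gamma_add_one (by positivity)]; ring_nf
  have e3 : Real.Gamma (β + k + m + 3) =
      (β + k + m + 2) * Real.Gamma (β + k + m + 2) := by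
    rw [← Real.Gamma_add_one (by positivity)]; ring_nf
  have p1 : Real.Gamma (β + k + 1) ≠ 0 := (Real.Gamma_pos_of_pos (by positivity)).ne'
  have p3 : β + k + 1 ≠ 0 := by positivity
  have g0 : Real.Gamma (m + 1) = m.factorial := Real.Gamma_nat_eq_factorial m
  have g1 : Real.Gamma (m + 1 + 1) = (m + 1) * m.factorial := by
    rw [Real.Gamma_add_one (by positivity), g0]
  have g2 : Real.Gamma (k + 1) = k.factorial := Real.Gamma_nat_eq_factorial k
  have g3 : Real.Gamma (k + 1 + 1) = (k + 1) * k.factorial := by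
    rw [Real.Gamma_add_one (by positivity), g2]
  push_cast [Nat.factorial_succ]
  simp only [zero_add]
  rw [g0, g1, g2, g3, show β + ((k : ℝ) + 1) + 1 = β + k + 2 by ring, e1,
    show β + ((k : ℝ) + 1) + (m + 1) + 1 = β + k + m + 3 by ring, e3,
    show β + (k : ℝ) + (m + 1) + 1 = β + k + m + 2 by ring,
    show β + 1 + (k : ℝ) + 1 = β + k + 2 by ring, e1,
    show β + 1 + (k : ℝ) + m + 1 = β + k + m + 2 by ring, hc']
  have hf : (k.factorial : ℝ) ≠ 0 := by positivity
  have hf' : (m.factorial : ℝ) ≠ 0 := by positivity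
  field_simp
  linear_combination hd'

lemma integral_one_sub_rpow_mul_rpow {α β : ℝ} (hα : 0 ≤ α) (hβ : 0 ≤ β) :
    ∫ s in (0 : ℝ)..1, (1 - s) ^ α * s ^ β =
      Real.Gamma (α + 1) * Real.Gamma (β + 1) / Real.Gamma (α + β + 2) := by
  have h := ProbabilityTheory.beta_eq_betaIntegralReal (β + 1) (α + 1) (by linarith) (by linarith)
  rw [ProbabilityTheory.beta, Complex.betaIntegral] at h
  have h2 : ∫ s in (0 : ℝ)..1, (s : ℂ) ^ (((β + 1 : ℝ) : ℂ) - 1) *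
      (1 - (s : ℂ)) ^ (((α + 1 : ℝ) : ℂ) - 1) =
      ∫ s in (0 : ℝ)..1, (((1 - s) ^ α * s ^ β : ℝ) : ℂ) := by
    apply intervalIntegral.integral_congr
    intro s hs
    rw [Set.uIcc_of_le zero_le_one] at hs
    simp only
    rw [Complex.ofReal_mul, Complex.ofReal_cpow hs.1, Complex.ofReal_cpow (by linarith [hs.2])]
    push_cast
    ring_nf
  rw [h2, intervalIntegral.integral_ofReal, Complex.ofReal_re] at h
  rw [← h]
  ring_nf

lemma hasDerivAt_eval_sub_one (P : Polynomial ℝ) (s : ℝ) :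
    HasDerivAt (fun s : ℝ => P.eval (s - 1)) (P.derivative.eval (s - 1)) s := by
  have h := (P.hasDerivAt (s - 1)).comp s ((hasDerivAt_id s).sub_const 1)
  rw [mul_one] at h
  exact h

lemma integral_jacobiPoly_succ_mul (n : ℕ) {α β : ℝ} (hα : 0 ≤ α) (hβ : 0 ≤ β)
    (Q : Polynomial ℝ) :
    ((n : ℝ) + 1) * ∫ s in (0 : ℝ)..1, (1 - s) ^ α * s ^ β *
        ((jacobiPoly (n + 1) α β).eval (s - 1) * Q.eval (s - 1)) =
      ∫ s in (0 : ℝ)..1, (1 - s) ^ (α + 1) * s ^ (β + 1) *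
        ((jacobiPoly n (α + 1) (β + 1)).eval (s - 1) * Q.derivative.eval (s - 1)) := by
  set R := jacobiPoly n (α + 1) (β + 1) with hR
  have hc1 : Continuous fun s : ℝ => (1 - s) ^ α * s ^ β *
        ((jacobiPoly (n + 1) α β).eval (s - 1) * Q.eval (s - 1)) := by
    have := Real.continuous_rpow_const hα
    have := Real.continuous_rpow_const hβ
    fun_prop
  have hc2 : Continuous fun s : ℝ => (1 - s) ^ (α + 1) * s ^ (β + 1) *
        (R.eval (s - 1) * Q.derivative.eval (s - 1)) := by
    have := Real.continuous_rpow_const (show 0 ≤ α + 1 by linarith)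
    have := Real.continuous_rpow_const (show 0 ≤ β + 1 by linarith)
    fun_prop
  have hd : ∀ s ∈ Set.uIcc (0 : ℝ) 1, HasDerivAt (fun s : ℝ => (1 - s) ^ (α + 1) * s ^ (β + 1) *
      (R.eval (s - 1) * Q.eval (s - 1)))
      ((1 - s) ^ (α + 1) * s ^ (β + 1) * (R.eval (s - 1) * Q.derivative.eval (s - 1)) -
        ((n : ℝ) + 1) * ((1 - s) ^ α * s ^ β *
        ((jacobiPoly (n + 1) α β).eval (s - 1) * Q.eval (s - 1)))) s := by
    intro s hs
    rw [Set.uIcc_of_le zero_le_one] at hs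
    have d1 : HasDerivAt (fun s : ℝ => (1 - s) ^ (α + 1)) (-1 * (α + 1) * (1 - s) ^ (α + 1 - 1)) s :=
      ((hasDerivAt_id s).const_sub 1).rpow_const (Or.inr (by linarith))
    have d2 : HasDerivAt (fun s : ℝ => s ^ (β + 1)) (1 * (β + 1) * s ^ (β + 1 - 1)) s :=
      (hasDerivAt_id s).rpow_const (Or.inr (by linarith))
    have d := (d1.mul d2).mul
      ((hasDerivAt_eval_sub_one R s).mul (hasDerivAt_eval_sub_one Q s))
    refine d.congr_deriv ?_
    have hro := congrArg (Polynomial.eval (s - 1)) (jacobiPoly_rodrigues n hα hβ)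
    simp only [Polynomial.eval_add, Polynomial.eval_mul, Polynomial.eval_X, Polynomial.eval_C,
      Polynomial.eval_one] at hro
    rw [← hR] at hro
    have e1 : (1 - s) ^ (α + 1) = (1 - s) ^ α * (1 - s) := by
      rcases eq_or_ne (1 - s) 0 with h | h
      · rw [h, Real.zero_rpow (by linarith)]; simp
      · rw [Real.rpow_add_one h]
    have e2 : s ^ (β + 1) = s ^ β * s := by
      rcases eq_or_ne s 0 with h | h
      · rw [h, Real.zero_rpow (by linarith)]; simp
      · rw [Real.rpow_add_one h]
    simp only [add_sub_cancel_right, Pi.mul_apply]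
    rw [e1, e2]
    linear_combination (-(1 - s) ^ α * s ^ β * Q.eval (s - 1)) * hro
  have hc3 := hc1.const_mul ((n : ℝ) + 1)
  have hint := intervalIntegral.integral_eq_sub_of_hasDerivAt hd
    ((hc2.sub hc3).intervalIntegrable _ _)
  rw [intervalIntegral.integral_sub (hc2.intervalIntegrable _ _)
    (hc3.intervalIntegrable _ _),
    intervalIntegral.integral_const_mul] at hint
  rw [sub_self, Real.zero_rpow (by linarith), Real.zero_rpow (by linarith)] at hint
  linarith

/-- Orthogonality and normalization of the Jacobi polynomials on `[0, 1]`. -/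
lemma integral_jacobiPoly_mul_jacobiPoly (n m : ℕ) {α β : ℝ} (hα : 0 ≤ α) (hβ : 0 ≤ β) :
    ∫ s in (0 : ℝ)..1, (1 - s) ^ α * s ^ β *
        ((jacobiPoly n α β).eval (s - 1) * (jacobiPoly m α β).eval (s - 1)) =
      if n = m then Real.Gamma (n + α + 1) * Real.Gamma (n + β + 1) /
        ((2 * n + α + β + 1) * n.factorial * Real.Gamma (n + α + β + 1)) else 0 := by
  induction n generalizing m α β with
  | zero =>
    rcases m with _ | m
    · simp only [jacobiPoly_zero hα hβ, if_true, Polynomial.eval_one, mul_one]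
      rw [integral_one_sub_rpow_mul_rpow hα hβ,
        show α + β + 2 = α + β + 1 + 1 by ring, Real.Gamma_add_one (s := α + β + 1) (by positivity)]
      simp
    · have h := integral_jacobiPoly_succ_mul m hα hβ 1
      simp only [Polynomial.derivative_one, Polynomial.eval_zero, mul_zero,
        intervalIntegral.integral_zero, Polynomial.eval_one, mul_one] at h
      simp only [jacobiPoly_zero hα hβ, Polynomial.eval_one, one_mul]
      rw [if_neg (by omega)]
      exact (mul_eq_zero.1 h).resolve_left (by positivity)
  | succ n ih =>
    have h := integral_jacobiPoly_succ_mul n hα hβ (jacobiPoly m α β)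
    have hn : (n : ℝ) + 1 ≠ 0 := by positivity
    rcases m with _ | m
    · simp only [jacobiPoly_zero hα hβ, Polynomial.derivative_one, Polynomial.eval_zero, mul_zero,
        intervalIntegral.integral_zero] at h
      rw [if_neg (by omega), jacobiPoly_zero hα hβ]
      exact (mul_eq_zero.1 h).resolve_left hn
    · have h' : ∀ s : ℝ, (1 - s) ^ (α + 1) * s ^ (β + 1) *
          ((jacobiPoly n (α + 1) (β + 1)).eval (s - 1) *
            (jacobiPoly (m + 1) α β).derivative.eval (s - 1)) =
          (α + β + m + 2) * ((1 - s) ^ (α + 1) * s ^ (β + 1) *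
          ((jacobiPoly n (α + 1) (β + 1)).eval (s - 1) *
            (jacobiPoly m (α + 1) (β + 1)).eval (s - 1))) := by
        intro s
        rw [derivative_jacobiPoly m hα hβ]
        simp only [Polynomial.eval_mul, Polynomial.eval_C]
        ring
      simp only [h'] at h
      rw [intervalIntegral.integral_const_mul, ih m (by linarith) (by linarith)] at h
      apply mul_left_cancel₀ hn
      rw [h]
      by_cases hnm : n = m
      · subst hnm
        simp only [if_true]
        have p1 : Real.Gamma (n + α + β + 2) ≠ 0 := (Real.Gamma_pos_of_pos (by positivity)).ne'
        have p3 : (n : ℝ) + α + β + 2 ≠ 0 := by positivity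
        have p4 : 2 * (n : ℝ) + α + β + 3 ≠ 0 := by positivity
        have e1 : Real.Gamma (n + α + β + 3) = (n + α + β + 2) * Real.Gamma (n + α + β + 2) := by
          rw [← Real.Gamma_add_one (by positivity)]; ring_nf
        push_cast [Nat.factorial_succ]
        rw [show (n : ℝ) + (α + 1) + (β + 1) + 1 = n + α + β + 3 by ring, e1,
          show (n : ℝ) + 1 + α + β + 1 = n + α + β + 2 by ring,
          show (n : ℝ) + 1 + α + 1 = n + (α + 1) + 1 by ring,
          show (n : ℝ) + 1 + β + 1 = n + (β + 1) + 1 by ring,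
          show 2 * (n : ℝ) + (α + 1) + (β + 1) + 1 = 2 * n + α + β + 3 by ring,
          show 2 * ((n : ℝ) + 1) + α + β + 1 = 2 * n + α + β + 3 by ring]
        have hf : (n.factorial : ℝ) ≠ 0 := by positivity
        field_simp
        ring
      · simp [hnm]

/-! Radial factors -/

/-- The radial polynomial of `genBallB`, in the variable `‖x‖² - 1`. -/
noncomputable def radialPoly (k n : ℕ) : Polynomial ℝ :=
  jacobiPoly k 0 ((n : ℝ) + 1 / 2) - jacobiPoly (k - 1) 0 ((n : ℝ) + 1 / 2)

/-- The radial factor of `genBallB`. -/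
noncomputable def radial (k n : ℕ) (r : ℝ) : ℝ := (radialPoly k n).eval (r ^ 2 - 1) * r ^ n

/-- The derivative of `radial`. -/
noncomputable def radialDeriv (k n : ℕ) (r : ℝ) : ℝ :=
  (radialPoly k n).derivative.eval (r ^ 2 - 1) * (2 * r) * r ^ n +
    (radialPoly k n).eval (r ^ 2 - 1) * (n * r ^ (n - 1))

lemma continuous_radial (k n : ℕ) : Continuous (radial k n) := by
  unfold radial; fun_prop

lemma continuous_radialDeriv (k n : ℕ) : Continuous (radialDeriv k n) := by
  unfold radialDeriv; fun_prop

lemma hasDerivAt_eval_sq_sub_one (P : Polynomial ℝ) (r : ℝ) :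
    HasDerivAt (fun r : ℝ => P.eval (r ^ 2 - 1)) (P.derivative.eval (r ^ 2 - 1) * (2 * r)) r := by
  have h := (P.hasDerivAt (r ^ 2 - 1)).comp r ((hasDerivAt_pow 2 r).sub_const 1)
  refine h.congr_deriv ?_
  simp

lemma hasDerivAt_radial (k n : ℕ) (r : ℝ) :
    HasDerivAt (radial k n) (radialDeriv k n r) r :=
  (hasDerivAt_eval_sq_sub_one _ r).mul (hasDerivAt_pow n r)

lemma integral_radial (k k' n : ℕ) (hk : 1 ≤ k) (hk' : 1 ≤ k') :
    (∫ r in (0 : ℝ)..1, r ^ 2 * (radialDeriv k n r * radialDeriv k' n r)) +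
      (n * (n + 1) : ℝ) * (∫ r in (0 : ℝ)..1, radial k n r * radial k' n r) =
      if k = k' then 2 * (n : ℝ) + 4 * k + 1 else 0 := by
  obtain ⟨k, rfl⟩ := Nat.exists_eq_add_of_le' hk
  obtain ⟨k', rfl⟩ := Nat.exists_eq_add_of_le' hk'
  set β : ℝ := (n : ℝ) + 1 / 2 with hβ
  have hβ0 : 0 ≤ β := by positivity
  have c1 : Continuous fun r : ℝ => r ^ 2 * (radialDeriv (k + 1) n r * radialDeriv (k' + 1) n r) :=
    (continuous_pow 2).mul ((continuous_radialDeriv _ _).mul (continuous_radialDeriv _ _))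
  have c2 : Continuous fun r : ℝ => radial (k + 1) n r * radial (k' + 1) n r :=
    (continuous_radial _ _).mul (continuous_radial _ _)
  have c2' := c2.const_mul (n * (n + 1) : ℝ)
  rw [← intervalIntegral.integral_const_mul,
    ← intervalIntegral.integral_add (c1.intervalIntegrable _ _) (c2'.intervalIntegrable _ _)]
  set F := radialPoly (k + 1) n with hF
  set G := radialPoly (k' + 1) n with hG
  set p : ℝ → ℝ := fun s => (1 - s) ^ (0 : ℝ) * s ^ (β + 1) *
    ((jacobiPoly k 0 (β + 1)).eval (s - 1) * (jacobiPoly k' 0 (β + 1)).eval (s - 1)) with hp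
  have hF' : F.derivative = Polynomial.C (2 * k + β + 2) * jacobiPoly k 0 (β + 1) :=
    derivative_jacobiPoly_sub k hβ0
  have hG' : G.derivative = Polynomial.C (2 * k' + β + 2) * jacobiPoly k' 0 (β + 1) :=
    derivative_jacobiPoly_sub k' hβ0
  have hF0 : F.eval 0 = 0 := by
    simp only [hF, radialPoly, Polynomial.eval_sub, jacobiPoly_eval_zero _ hβ0, ← hβ, sub_self]
  set bd : ℝ → ℝ := fun r => F.eval (r ^ 2 - 1) * G.eval (r ^ 2 - 1) * (n * r ^ (2 * n + 1)) with hbd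
  set bd' : ℝ → ℝ := fun r =>
    (F.derivative.eval (r ^ 2 - 1) * (2 * r) * G.eval (r ^ 2 - 1) +
      F.eval (r ^ 2 - 1) * (G.derivative.eval (r ^ 2 - 1) * (2 * r))) * (n * r ^ (2 * n + 1)) +
    F.eval (r ^ 2 - 1) * G.eval (r ^ 2 - 1) * (n * ((2 * n + 1 : ℝ) * r ^ (2 * n))) with hbd'
  have hdbd : ∀ r, HasDerivAt bd (bd' r) r := by
    intro r
    refine (((hasDerivAt_eval_sq_sub_one F r).mul (hasDerivAt_eval_sq_sub_one G r)).mul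
      ((hasDerivAt_pow (2 * n + 1) r).const_mul (n : ℝ))).congr_deriv ?_
    simp [hbd']
  have cbd' : Continuous bd' := by rw [hbd']; fun_prop
  have cp : Continuous p := by
    have := Real.continuous_rpow_const (show (0 : ℝ) ≤ 0 by simp)
    have := Real.continuous_rpow_const (show 0 ≤ β + 1 by linarith)
    rw [hp]; fun_prop
  have cp2 : Continuous fun r : ℝ => (p ∘ fun r : ℝ => r ^ 2) r * (2 * r) := by
    exact (cp.comp (continuous_pow 2)).mul (by fun_prop)
  have hI : ∫ r in (0 : ℝ)..1, (p ∘ fun r : ℝ => r ^ 2) r * (2 * r) = ∫ s in (0 : ℝ)..1, p s := by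
    rw [intervalIntegral.integral_comp_mul_deriv (f := fun r : ℝ => r ^ 2)
      (fun r _ => by simpa using hasDerivAt_pow 2 r) (by fun_prop) cp]
    simp
  have hcong : ∀ r ∈ Set.uIcc (0 : ℝ) 1,
      r ^ 2 * (radialDeriv (k + 1) n r * radialDeriv (k' + 1) n r) +
        (n * (n + 1) : ℝ) * (radial (k + 1) n r * radial (k' + 1) n r) =
      (2 * (2 * k + β + 2) * (2 * k' + β + 2)) * ((p ∘ fun r : ℝ => r ^ 2) r * (2 * r)) + bd' r := by
    intro r hr
    rw [Set.uIcc_of_le zero_le_one] at hr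
    have e1 : (r ^ 2) ^ (β + 1) = r ^ (2 * n + 3) := by
      rw [← Real.rpow_natCast r 2, ← Real.rpow_mul hr.1, ← Real.rpow_natCast, hβ]
      congr 1
      push_cast
      ring
    simp only [radialDeriv, radial, ← hF, ← hG, hbd', hp, Function.comp, e1, hF', hG',
      Polynomial.eval_mul, Polynomial.eval_C, Real.rpow_zero]
    rcases n with _ | n
    · simp; ring
    · simp only [Nat.add_sub_cancel]
      push_cast
      ring
  rw [intervalIntegral.integral_congr hcong,
    intervalIntegral.integral_add ((cp2.const_mul _).intervalIntegrable _ _)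
      (cbd'.intervalIntegrable _ _),
    intervalIntegral.integral_eq_sub_of_hasDerivAt (fun r _ => hdbd r)
      (cbd'.intervalIntegrable _ _), intervalIntegral.integral_const_mul, hI]
  have hend : bd 1 - bd 0 = 0 := by
    simp [hbd, hF0]
  have hval := integral_jacobiPoly_mul_jacobiPoly k k' (le_refl (0 : ℝ)) (show 0 ≤ β + 1 by linarith)
  rw [hend, add_zero, hp, hval]
  by_cases h : k = k'
  · subst h
    have g1 : Real.Gamma (k + 0 + 1) = k.factorial := by
      simpa using Real.Gamma_nat_eq_factorial k
    have p1 : Real.Gamma (k + 0 + (β + 1) + 1) ≠ 0 := (Real.Gamma_pos_of_pos (by positivity)).ne'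
    have hf : (k.factorial : ℝ) ≠ 0 := by positivity
    have p3 : 2 * (k : ℝ) + β + 2 ≠ 0 := by positivity
    simp only [if_true]
    rw [g1, show 2 * (k : ℝ) + 0 + (β + 1) + 1 = 2 * k + β + 2 by ring,
      show (k : ℝ) + (β + 1) + 1 = k + 0 + (β + 1) + 1 by ring]
    field_simp
    rw [hβ]
    push_cast
    ring
  · simp [h]

/-! Polar-angle factors -/

/-- The factor of `sphY` depending on the polar angle, up to normalization. -/
noncomputable def polarFactor (n j : ℕ) (θ : ℝ) : ℝ :=
  sin θ ^ j * (jacobiPoly (n - j) j j).eval ((cos θ - 1) / 2)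

/-- The derivative of `polarFactor`. -/
noncomputable def polarFactorDeriv (n j : ℕ) (θ : ℝ) : ℝ :=
  j * sin θ ^ (j - 1) * cos θ * (jacobiPoly (n - j) j j).eval ((cos θ - 1) / 2) +
    sin θ ^ j * ((jacobiPoly (n - j) j j).derivative.eval ((cos θ - 1) / 2) * (-sin θ / 2))

lemma continuous_polarFactor (n j : ℕ) : Continuous (polarFactor n j) := by
  unfold polarFactor; fun_prop

lemma continuous_polarFactorDeriv (n j : ℕ) : Continuous (polarFactorDeriv n j) := by
  unfold polarFactorDeriv; fun_prop

lemma hasDerivAt_eval_cos (P : Polynomial ℝ) (θ : ℝ) :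
    HasDerivAt (fun θ : ℝ => P.eval ((cos θ - 1) / 2))
      (P.derivative.eval ((cos θ - 1) / 2) * (-sin θ / 2)) θ :=
  HasDerivAt.comp (h := fun θ : ℝ => (cos θ - 1) / 2) θ (P.hasDerivAt ((cos θ - 1) / 2))
    (((hasDerivAt_cos θ).sub_const 1).div_const 2)

lemma hasDerivAt_polarFactor (n j : ℕ) (θ : ℝ) :
    HasDerivAt (polarFactor n j) (polarFactorDeriv n j θ) θ :=
  ((hasDerivAt_sin θ).pow j).mul (hasDerivAt_eval_cos _ θ)

lemma integral_sin_pow_mul_eval_cos (j : ℕ) (P Q : Polynomial ℝ) :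
    ∫ θ in (0 : ℝ)..π, sin θ ^ (2 * j + 1) *
        (P.eval ((cos θ - 1) / 2) * Q.eval ((cos θ - 1) / 2)) =
      2 * 4 ^ j * ∫ s in (0 : ℝ)..1, (1 - s) ^ (j : ℝ) * s ^ (j : ℝ) *
        (P.eval (s - 1) * Q.eval (s - 1)) := by
  simp only [Real.rpow_natCast]
  set p : ℝ → ℝ := fun s => (1 - s) ^ j * s ^ j * (P.eval (s - 1) * Q.eval (s - 1)) with hp
  have cp : Continuous p := by rw [hp]; fun_prop
  have h := intervalIntegral.integral_comp_mul_deriv (a := 0) (b := π)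
    (f := fun θ : ℝ => (1 + cos θ) / 2) (f' := fun θ => -sin θ / 2) (g := p)
    (fun θ _ => ((hasDerivAt_cos θ).const_add 1).div_const 2) (by fun_prop) cp
  rw [cos_zero, cos_pi, show ((1 : ℝ) + -1) / 2 = 0 by norm_num,
    show ((1 : ℝ) + 1) / 2 = 1 by norm_num, intervalIntegral.integral_symm 0 1, ← neg_eq_iff_eq_neg,
    ← intervalIntegral.integral_neg] at h
  rw [← h, ← intervalIntegral.integral_const_mul]
  congr 1
  ext θ
  simp only [hp, Function.comp]
  have e : (1 - (1 + cos θ) / 2) * ((1 + cos θ) / 2) = sin θ ^ 2 / 4 := by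
    rw [sin_sq]; ring
  rw [← mul_pow, e, show (1 + cos θ) / 2 - 1 = (cos θ - 1) / 2 by ring, div_pow, ← pow_mul]
  field_simp
  ring

/-- The squared norm of `polarFactor n j` for the weight `sin`. -/
noncomputable def polarNorm (n j : ℕ) : ℝ :=
  2 * 4 ^ j * (n.factorial * n.factorial / ((2 * n + 1) * (n - j).factorial * (n + j).factorial))

lemma integral_sin_pow_mul_jacobiPoly (n m j : ℕ) (hn : j ≤ n) (hm : j ≤ m) :
    ∫ θ in (0 : ℝ)..π, sin θ ^ (2 * j + 1) *
        ((jacobiPoly (n - j) j j).eval ((cos θ - 1) / 2) *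
          (jacobiPoly (m - j) j j).eval ((cos θ - 1) / 2)) =
      if n = m then polarNorm n j else 0 := by
  rw [integral_sin_pow_mul_eval_cos, integral_jacobiPoly_mul_jacobiPoly _ _ (by positivity)
    (by positivity)]
  by_cases h : n = m
  · subst h
    simp only [if_true, polarNorm]
    have h1 : ((n - j : ℕ) : ℝ) = n - j := Nat.cast_sub hn
    rw [← Real.Gamma_nat_eq_factorial n, ← Real.Gamma_nat_eq_factorial (n + j), h1]
    push_cast
    congr 2
    · ring_nf
    · ring_nf
  · have h' : n - j ≠ m - j := by omega
    simp [h, h']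

lemma integral_sin_mul_polarFactor (n m j : ℕ) (hn : j ≤ n) (hm : j ≤ m) :
    ∫ θ in (0 : ℝ)..π, sin θ * (polarFactor n j θ * polarFactor m j θ) =
      if n = m then polarNorm n j else 0 := by
  rw [← integral_sin_pow_mul_jacobiPoly n m j hn hm]
  congr 1
  ext θ
  simp only [polarFactor]
  ring

lemma integral_sin_pow_mul_derivative (n m j : ℕ) (hn : j ≤ n) (hm : j ≤ m) :
    ∫ θ in (0 : ℝ)..π, sin θ ^ (2 * j + 3) *
        ((jacobiPoly (n - j) j j).derivative.eval ((cos θ - 1) / 2) *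
          (jacobiPoly (m - j) j j).derivative.eval ((cos θ - 1) / 2)) =
      if n = m then 4 * (n * (n + 1) - j * (j + 1)) * polarNorm n j else 0 := by
  rcases hn.eq_or_lt with rfl | hn'
  · simp [jacobiPoly_zero (Nat.cast_nonneg j) (Nat.cast_nonneg j)]
  rcases hm.eq_or_lt with rfl | hm'
  · simp [jacobiPoly_zero (Nat.cast_nonneg j) (Nat.cast_nonneg j)]
    omega
  have hd : ∀ n : ℕ, j < n → (jacobiPoly (n - j) j j).derivative =
      Polynomial.C (n + j + 1 : ℝ) * jacobiPoly (n - (j + 1)) ((j + 1 : ℕ) : ℝ) ((j + 1 : ℕ) : ℝ) := by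
    intro n h
    obtain ⟨q, rfl⟩ := Nat.exists_eq_add_of_lt h
    rw [show j + q + 1 - j = q + 1 by omega, show j + q + 1 - (j + 1) = q by omega,
      derivative_jacobiPoly _ (Nat.cast_nonneg j) (Nat.cast_nonneg j)]
    push_cast
    congr 2
    ring
  have h := integral_sin_pow_mul_jacobiPoly n m (j + 1) hn' hm'
  rw [hd n hn', hd m hm']
  simp only [Polynomial.eval_mul, Polynomial.eval_C]
  have h2 : ∀ θ : ℝ, sin θ ^ (2 * j + 3) *
      ((n + j + 1) * (jacobiPoly (n - (j + 1)) ((j + 1 : ℕ) : ℝ) ((j + 1 : ℕ) : ℝ)).eval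
          ((cos θ - 1) / 2) * ((m + j + 1) *
        (jacobiPoly (m - (j + 1)) ((j + 1 : ℕ) : ℝ) ((j + 1 : ℕ) : ℝ)).eval
          ((cos θ - 1) / 2))) =
      ((n + j + 1) * (m + j + 1)) * (sin θ ^ (2 * (j + 1) + 1) *
      ((jacobiPoly (n - (j + 1)) ((j + 1 : ℕ) : ℝ) ((j + 1 : ℕ) : ℝ)).eval
          ((cos θ - 1) / 2) *
        (jacobiPoly (m - (j + 1)) ((j + 1 : ℕ) : ℝ) ((j + 1 : ℕ) : ℝ)).eval
          ((cos θ - 1) / 2))) := by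
    intro θ; ring
  simp only [h2]
  rw [intervalIntegral.integral_const_mul, h]
  by_cases hnm : n = m
  · subst hnm
    simp only [if_true, polarNorm]
    obtain ⟨q, rfl⟩ := Nat.exists_eq_add_of_lt hn'
    rw [show j + q + 1 - j = q + 1 by omega, show j + q + 1 - (j + 1) = q by omega,
      show j + q + 1 + (j + 1) = (j + q + 1 + j) + 1 by omega, Nat.factorial_succ (j + q + 1 + j),
      Nat.factorial_succ q]
    have f1 : (q.factorial : ℝ) ≠ 0 := by positivity
    have f2 : ((j + q + 1 + j).factorial : ℝ) ≠ 0 := by positivity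
    push_cast
    field_simp
    ring
  · simp [hnm]

lemma integral_polarFactorDeriv (n m j : ℕ) (hn : j ≤ n) (hm : j ≤ m) :
    (∫ θ in (0 : ℝ)..π, sin θ * (polarFactorDeriv n j θ * polarFactorDeriv m j θ)) +
      (j : ℝ) ^ 2 * (∫ θ in (0 : ℝ)..π, sin θ ^ (2 * j - 1) *
        ((jacobiPoly (n - j) j j).eval ((cos θ - 1) / 2) *
          (jacobiPoly (m - j) j j).eval ((cos θ - 1) / 2))) =
      if n = m then n * (n + 1) * polarNorm n j else 0 := by
  have h1 := integral_sin_pow_mul_jacobiPoly n m j hn hm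
  have h2 := integral_sin_pow_mul_derivative n m j hn hm
  set P := jacobiPoly (n - j) j j with hP
  set Q := jacobiPoly (m - j) j j with hQ
  have c1 : Continuous fun θ => sin θ * (polarFactorDeriv n j θ * polarFactorDeriv m j θ) :=
    continuous_sin.mul ((continuous_polarFactorDeriv _ _).mul (continuous_polarFactorDeriv _ _))
  have c2 : Continuous fun θ => (j : ℝ) ^ 2 * (sin θ ^ (2 * j - 1) *
        (P.eval ((cos θ - 1) / 2) * Q.eval ((cos θ - 1) / 2))) := by fun_prop
  have c3 : Continuous fun θ => (j * (j + 1) : ℝ) * (sin θ ^ (2 * j + 1) *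
        (P.eval ((cos θ - 1) / 2) * Q.eval ((cos θ - 1) / 2))) := by fun_prop
  have c4 : Continuous fun θ => (1 / 4 : ℝ) * (sin θ ^ (2 * j + 3) *
        (P.derivative.eval ((cos θ - 1) / 2) * Q.derivative.eval ((cos θ - 1) / 2))) := by fun_prop
  set bd : ℝ → ℝ := fun θ => j * (sin θ ^ (2 * j) * cos θ *
    (P.eval ((cos θ - 1) / 2) * Q.eval ((cos θ - 1) / 2))) with hbd
  set bd' : ℝ → ℝ := fun θ => j * (((2 * j : ℝ) * sin θ ^ (2 * j - 1) * cos θ * cos θ +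
      sin θ ^ (2 * j) * (-sin θ)) * (P.eval ((cos θ - 1) / 2) * Q.eval ((cos θ - 1) / 2)) +
    sin θ ^ (2 * j) * cos θ *
      (P.derivative.eval ((cos θ - 1) / 2) * (-sin θ / 2) * Q.eval ((cos θ - 1) / 2) +
        P.eval ((cos θ - 1) / 2) * (Q.derivative.eval ((cos θ - 1) / 2) * (-sin θ / 2)))) with hbd'
  have hdbd : ∀ θ, HasDerivAt bd (bd' θ) θ := by
    intro θ
    refine (((((hasDerivAt_sin θ).pow (2 * j)).mul (hasDerivAt_cos θ)).mul
      ((hasDerivAt_eval_cos P θ).mul (hasDerivAt_eval_cos Q θ))).const_mul (j : ℝ)).congr_deriv ?_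
    simp [hbd']
  have cbd' : Continuous bd' := by rw [hbd']; fun_prop
  rw [← intervalIntegral.integral_const_mul,
    ← intervalIntegral.integral_add (c1.intervalIntegrable _ _) (c2.intervalIntegrable _ _)]
  have hcong : ∀ θ : ℝ, sin θ * (polarFactorDeriv n j θ * polarFactorDeriv m j θ) +
      (j : ℝ) ^ 2 * (sin θ ^ (2 * j - 1) *
        (P.eval ((cos θ - 1) / 2) * Q.eval ((cos θ - 1) / 2))) =
      bd' θ + ((j * (j + 1) : ℝ) * (sin θ ^ (2 * j + 1) *
        (P.eval ((cos θ - 1) / 2) * Q.eval ((cos θ - 1) / 2))) +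
      (1 / 4 : ℝ) * (sin θ ^ (2 * j + 3) *
        (P.derivative.eval ((cos θ - 1) / 2) * Q.derivative.eval ((cos θ - 1) / 2)))) := by
    intro θ
    simp only [polarFactorDeriv, ← hP, ← hQ, hbd']
    rcases j with _ | j
    · simp; ring
    · rw [show 2 * (j + 1) - 1 = 2 * j + 1 by omega, Nat.add_sub_cancel]
      push_cast
      have hcs := sin_sq_add_cos_sq θ
      linear_combination (-((j : ℝ) + 1) ^ 2 * sin θ ^ (2 * j + 1) *
        (P.eval ((cos θ - 1) / 2) * Q.eval ((cos θ - 1) / 2))) * hcs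
  have c5 := c3.add c4
  simp only [Pi.add_def] at c5
  have hend : bd π - bd 0 = 0 := by
    rcases j with _ | j <;> simp [hbd]
  simp only [hcong]
  rw [intervalIntegral.integral_add (cbd'.intervalIntegrable _ _)
      (c5.intervalIntegrable _ _),
    intervalIntegral.integral_add (c3.intervalIntegrable _ _) (c4.intervalIntegrable _ _),
    intervalIntegral.integral_eq_sub_of_hasDerivAt (fun r _ => hdbd r)
      (cbd'.intervalIntegrable _ _), intervalIntegral.integral_const_mul,
    intervalIntegral.integral_const_mul, hend, h1, h2]
  by_cases hnm : n = m
  · simp only [hnm, if_true]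
    ring
  · simp [hnm]

/-! Azimuthal factors -/

/-- The factor of `sphY n l` depending on the azimuthal angle. -/
noncomputable def azimuth (l : ℕ) (φ : ℝ) : ℝ :=
  if l = 1 ∨ l % 2 = 0 then cos ((l / 2 : ℕ) * φ) else sin ((l / 2 : ℕ) * φ)

/-- The derivative of `azimuth`. -/
noncomputable def azimuthDeriv (l : ℕ) (φ : ℝ) : ℝ :=
  (l / 2 : ℕ) * (if l = 1 ∨ l % 2 = 0 then -sin ((l / 2 : ℕ) * φ) else cos ((l / 2 : ℕ) * φ))

lemma continuous_azimuth (l : ℕ) : Continuous (azimuth l) := by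
  unfold azimuth; split_ifs <;> fun_prop

lemma continuous_azimuthDeriv (l : ℕ) : Continuous (azimuthDeriv l) := by
  unfold azimuthDeriv; split_ifs <;> fun_prop

lemma hasDerivAt_azimuth (l : ℕ) (φ : ℝ) :
    HasDerivAt (azimuth l) (azimuthDeriv l φ) φ := by
  have h : HasDerivAt (fun φ : ℝ => ((l / 2 : ℕ) : ℝ) * φ) ((l / 2 : ℕ) : ℝ) φ := by
    simpa using (hasDerivAt_id φ).const_mul ((l / 2 : ℕ) : ℝ)
  unfold azimuth azimuthDeriv
  split_ifs
  · exact h.cos.congr_deriv (by ring)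
  · exact h.sin.congr_deriv (by ring)

lemma integral_cos_int_mul (m : ℤ) :
    ∫ φ in (-π)..π, cos (m * φ) = if m = 0 then 2 * π else 0 := by
  split_ifs with h
  · subst h; simp; ring
  · have hm : (m : ℝ) ≠ 0 := by exact_mod_cast h
    rw [intervalIntegral.integral_comp_mul_left (fun x => cos x) hm, integral_cos]
    simp

lemma integral_cos_nat_mul_cos_nat_mul (a b : ℕ) :
    ∫ φ in (-π)..π, cos (a * φ) * cos (b * φ) =
      if a = b then (if a = 0 then 2 * π else π) else 0 := by
  have h : ∀ φ : ℝ, cos (a * φ) * cos (b * φ) =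
      (1 / 2) * (cos (((a - b : ℤ) : ℝ) * φ) + cos (((a + b : ℤ) : ℝ) * φ)) := by
    intro φ
    push_cast
    rw [sub_mul, add_mul, cos_sub, cos_add]; ring
  simp only [h]
  rw [intervalIntegral.integral_const_mul, intervalIntegral.integral_add
    (Continuous.intervalIntegrable (by fun_prop) _ _)
    (Continuous.intervalIntegrable (by fun_prop) _ _),
    integral_cos_int_mul, integral_cos_int_mul]
  split_ifs <;> first | omega | ring

lemma integral_sin_nat_mul_sin_nat_mul (a b : ℕ) (ha : a ≠ 0) :
    ∫ φ in (-π)..π, sin (a * φ) * sin (b * φ) = if a = b then π else 0 := by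
  have h : ∀ φ : ℝ, sin (a * φ) * sin (b * φ) =
      (1 / 2) * (cos (((a - b : ℤ) : ℝ) * φ) - cos (((a + b : ℤ) : ℝ) * φ)) := by
    intro φ
    push_cast
    rw [sub_mul, add_mul, cos_sub, cos_add]; ring
  simp only [h]
  rw [intervalIntegral.integral_const_mul, intervalIntegral.integral_sub
    (Continuous.intervalIntegrable (by fun_prop) _ _)
    (Continuous.intervalIntegrable (by fun_prop) _ _),
    integral_cos_int_mul, integral_cos_int_mul]
  split_ifs <;> first | omega | ring

lemma integral_sin_nat_mul_cos_nat_mul (a b : ℕ) :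
    ∫ φ in (-π)..π, sin (a * φ) * cos (b * φ) = 0 := by
  have h := intervalIntegral.integral_comp_neg (a := -π) (b := π)
    (fun φ : ℝ => sin (a * φ) * cos (b * φ))
  simp only [mul_neg, sin_neg, cos_neg, neg_mul, neg_neg] at h
  rw [intervalIntegral.integral_neg] at h
  linarith

lemma integral_azimuth_mul_azimuth (l l' : ℕ) (hl : 1 ≤ l) (hl' : 1 ≤ l') :
    ∫ φ in (-π)..π, azimuth l φ * azimuth l' φ =
      if l = l' then (if l = 1 then 2 * π else π) else 0 := by
  have hs : ∀ φ : ℝ, ∀ a b : ℕ, cos (a * φ) * sin (b * φ) = sin (b * φ) * cos (a * φ) :=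
    fun φ a b => mul_comm _ _
  unfold azimuth
  by_cases h : l = 1 ∨ l % 2 = 0 <;> by_cases h' : l' = 1 ∨ l' % 2 = 0
  · simp only [h, h', if_true, integral_cos_nat_mul_cos_nat_mul]
    split_ifs <;> first | omega | rfl
  · simp only [h, h', if_true, if_false, hs, integral_sin_nat_mul_cos_nat_mul]
    split_ifs <;> first | omega | rfl
  · simp only [h, h', if_true, if_false, integral_sin_nat_mul_cos_nat_mul]
    split_ifs <;> first | omega | rfl
  · simp only [h, h', if_false]
    rw [integral_sin_nat_mul_sin_nat_mul _ _ (by omega)]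
    split_ifs <;> first | omega | rfl

lemma integral_azimuthDeriv_mul_azimuthDeriv (l l' : ℕ) (hl : 1 ≤ l) (hl' : 1 ≤ l') :
    ∫ φ in (-π)..π, azimuthDeriv l φ * azimuthDeriv l' φ =
      if l = l' then ((l / 2 : ℕ) : ℝ) ^ 2 * (if l = 1 then 2 * π else π) else 0 := by
  rcases hl.eq_or_lt with rfl | hl2
  · simp [azimuthDeriv]
  rcases hl'.eq_or_lt with rfl | hl2'
  · simp [azimuthDeriv]
    omega
  have hs : ∀ φ : ℝ, ∀ a b : ℕ, (-sin (a * φ)) * cos (b * φ) = -(sin (a * φ) * cos (b * φ)) :=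
    fun φ a b => neg_mul _ _
  have hs' : ∀ φ : ℝ, ∀ a b : ℕ, cos (a * φ) * (-sin (b * φ)) = -(sin (b * φ) * cos (a * φ)) :=
    fun φ a b => by ring
  have hm : ∀ a b c d : ℝ, (a * b) * (c * d) = (a * c) * (b * d) := fun a b c d => by ring
  unfold azimuthDeriv
  simp only [hm]
  rw [intervalIntegral.integral_const_mul]
  by_cases h : l = 1 ∨ l % 2 = 0 <;> by_cases h' : l' = 1 ∨ l' % 2 = 0
  · simp only [h, h', if_true, neg_mul_neg]
    rw [integral_sin_nat_mul_sin_nat_mul _ _ (by omega)]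
    split_ifs <;> first | omega | simp [sq, *]
  · simp only [h, h', if_true, if_false, hs, intervalIntegral.integral_neg,
      integral_sin_nat_mul_cos_nat_mul]
    split_ifs <;> first | omega | simp
  · simp only [h, h', if_true, if_false, hs', intervalIntegral.integral_neg,
      integral_sin_nat_mul_cos_nat_mul]
    split_ifs <;> first | omega | simp
  · simp only [h, h', if_false]
    rw [integral_cos_nat_mul_cos_nat_mul]
    split_ifs <;> first | omega | simp [sq, *]

/-! Factorization of `sphY` -/

/-- The normalization constant of `sphY n l`. -/
noncomputable def sphCoeff (n l : ℕ) : ℝ :=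
  if l = 1 then Real.sqrt ((2 * n + 1) / (4 * Real.pi)) else sphC n (l / 2)

lemma sphY_eq (n l : ℕ) (θ φ : ℝ) :
    sphY n l θ φ = sphCoeff n l * polarFactor n (l / 2) θ * azimuth l φ := by
  unfold sphY sphCoeff polarFactor azimuth
  by_cases h1 : l = 1
  · subst h1
    simp [jacobiP_eq_eval]
  · by_cases h2 : l % 2 = 0
    · simp only [h1, h2, if_true, if_false, jacobiP_eq_eval, or_true]; ring
    · simp only [h1, h2, if_false, jacobiP_eq_eval, or_self]; ring

lemma sphCoeff_sq_mul (n l : ℕ) (hl : 1 ≤ l) (hln : l ≤ 2 * n + 1) :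
    sphCoeff n l ^ 2 * polarNorm n (l / 2) * (if l = 1 then 2 * π else π) = 1 := by
  have hπ := Real.pi_pos
  have hf : (n.factorial : ℝ) ≠ 0 := by positivity
  unfold sphCoeff polarNorm
  by_cases h1 : l = 1
  · subst h1
    simp only [if_true]
    rw [Real.sq_sqrt (by positivity)]
    simp
    field_simp
    ring
  · simp only [h1, if_false, sphC]
    set j := l / 2 with hj
    have hjn : j ≤ n := by omega
    rw [show (n : ℝ) - j = ((n - j : ℕ) : ℝ) from (Nat.cast_sub hjn).symm,
      show (n : ℝ) + j = ((n + j : ℕ) : ℝ) from (Nat.cast_add n j).symm,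
      Real.Gamma_nat_eq_factorial, Real.Gamma_nat_eq_factorial, Real.Gamma_nat_eq_factorial,
      mul_pow, Real.sq_sqrt (by positivity)]
    have h4 : ((2 : ℝ) ^ j) ^ 2 = 4 ^ j := by rw [← pow_mul, mul_comm, pow_mul]; norm_num
    rw [div_pow, h4]
    have f1 : ((n - j).factorial : ℝ) ≠ 0 := by positivity
    have f2 : ((n + j).factorial : ℝ) ≠ 0 := by positivity
    field_simp

/-! Spherical coordinates -/

/-- The point of `ℝ³` with spherical coordinates `(r, θ, φ)`. -/
noncomputable def spherePt (r θ φ : ℝ) : E3 :=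
  !₂[r * sin θ * cos φ, r * sin θ * sin φ, r * cos θ]

/-- The polar angle of a point of `ℝ³`. -/
noncomputable def polarAngle (x : E3) : ℝ := arccos (‖x‖⁻¹ * x 2)

/-- The azimuthal angle of a point of `ℝ³`. -/
noncomputable def azimuthAngle (x : E3) : ℝ := Complex.arg (x 0 + x 1 * Complex.I)

lemma norm_spherePt {r : ℝ} (hr : 0 ≤ r) (θ φ : ℝ) : ‖spherePt r θ φ‖ = r := by
  rw [← sq_eq_sq₀ (norm_nonneg _) hr, EuclideanSpace.real_norm_sq_eq]
  simp only [spherePt, Fin.sum_univ_three]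
  simp
  linear_combination (r * sin θ) ^ 2 * sin_sq_add_cos_sq φ + r ^ 2 * sin_sq_add_cos_sq θ

lemma polarAngle_spherePt {r θ : ℝ} (hr : 0 < r) (hθ : θ ∈ Set.Ioo 0 π) (φ : ℝ) :
    polarAngle (spherePt r θ φ) = θ := by
  rw [polarAngle, norm_spherePt hr.le]
  simp only [spherePt]
  simp [hr.ne', arccos_cos hθ.1.le hθ.2.le]

lemma azimuthAngle_spherePt {r θ φ : ℝ} (hr : 0 < r) (hθ : θ ∈ Set.Ioo 0 π)
    (hφ : φ ∈ Set.Ioo (-π) π) : azimuthAngle (spherePt r θ φ) = φ := by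
  have h := Complex.arg_mul_cos_add_sin_mul_I (r := r * sin θ)
    (mul_pos hr (sin_pos_of_mem_Ioo hθ)) (Set.Ioo_subset_Ioc_self hφ)
  rw [azimuthAngle]
  convert h using 2
  simp [spherePt]
  ring

lemma spherePt_polarAngle_azimuthAngle {x : E3} (hx : x 1 ≠ 0) :
    polarAngle x ∈ Set.Ioo 0 π ∧ azimuthAngle x ∈ Set.Ioo (-π) π ∧
      spherePt ‖x‖ (polarAngle x) (azimuthAngle x) = x := by
  have hx0 : x ≠ 0 := by rintro rfl; simp at hx
  have hn : 0 < ‖x‖ := norm_pos_iff.2 hx0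
  have hsq : ‖x‖ ^ 2 = x 0 ^ 2 + x 1 ^ 2 + x 2 ^ 2 := by
    rw [EuclideanSpace.real_norm_sq_eq, Fin.sum_univ_three]
  have h1 : 0 < x 1 ^ 2 := by positivity
  have habs : |‖x‖⁻¹ * x 2| < 1 := by
    rw [abs_mul, abs_inv, abs_norm, inv_mul_lt_one₀ hn]
    apply lt_of_pow_lt_pow_left₀ 2 hn.le
    rw [sq_abs]
    nlinarith [sq_nonneg (x 0)]
  obtain ⟨hl, hu⟩ := abs_lt.1 habs
  have hz : (x 0 + x 1 * Complex.I : ℂ) ≠ 0 := by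
    intro h
    have := congrArg Complex.im h
    simp at this
    exact hx this
  have hs : ‖x‖ * sin (polarAngle x) = ‖(x 0 + x 1 * Complex.I : ℂ)‖ := by
    rw [polarAngle, sin_arccos, Complex.norm_add_mul_I, ← Real.sqrt_sq hn.le,
      ← Real.sqrt_mul (sq_nonneg _), Real.sqrt_sq hn.le]
    congr 1
    field_simp
    linarith
  have hc : ‖x‖ * cos (polarAngle x) = x 2 := by
    rw [polarAngle, cos_arccos hl.le hu.le]
    field_simp
  refine ⟨⟨arccos_pos.2 hu, ?_⟩, ⟨Complex.neg_pi_lt_arg _, ?_⟩, ?_⟩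
  · exact lt_of_le_of_ne (arccos_le_pi _) (fun h => by linarith [arccos_eq_pi.1 h])
  · refine lt_of_le_of_ne (Complex.arg_le_pi _) (fun h => ?_)
    have h2 := (Complex.arg_eq_pi_iff.1 h).2
    simp at h2
    exact hx h2
  · ext i
    fin_cases i
    · simp only [spherePt, hs, azimuthAngle]
      simp [Complex.norm_mul_cos_arg]
    · simp only [spherePt, hs, azimuthAngle]
      simp [Complex.norm_mul_sin_arg]
    · simp only [spherePt, hc]
      simp

/-- The function with separated spherical variables. -/
noncomputable def separated (R Θ Φ : ℝ → ℝ) (x : E3) : ℝ :=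
  R ‖x‖ * Θ (polarAngle x) * Φ (azimuthAngle x)

lemma separated_spherePt (R Θ Φ : ℝ → ℝ) {r θ φ : ℝ} (hr : 0 < r) (hθ : θ ∈ Set.Ioo 0 π)
    (hφ : φ ∈ Set.Ioo (-π) π) : separated R Θ Φ (spherePt r θ φ) = R r * Θ θ * Φ φ := by
  rw [separated, norm_spherePt hr.le, polarAngle_spherePt hr hθ, azimuthAngle_spherePt hr hθ hφ]

lemma differentiableAt_separated {R Θ Φ : ℝ → ℝ} {r θ φ : ℝ} (hr : 0 < r)
    (hθ : θ ∈ Set.Ioo 0 π) (hφ : φ ∈ Set.Ioo (-π) π) (hR : DifferentiableAt ℝ R r)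
    (hΘ : DifferentiableAt ℝ Θ θ) (hΦ : DifferentiableAt ℝ Φ φ) :
    DifferentiableAt ℝ (separated R Θ Φ) (spherePt r θ φ) := by
  set x := spherePt r θ φ with hx
  have hn : ‖x‖ = r := norm_spherePt hr.le θ φ
  have hx0 : x ≠ 0 := norm_pos_iff.1 (hn ▸ hr)
  have hcoord : ∀ i, DifferentiableAt ℝ (fun y : E3 => y i) x := fun i => by fun_prop
  have dn : DifferentiableAt ℝ (fun y : E3 => ‖y‖) x := differentiableAt_id.norm ℝ hx0
  have dp : DifferentiableAt ℝ polarAngle x := by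
    have hs := sin_pos_of_mem_Ioo hθ
    have hv : ‖x‖⁻¹ * x 2 = cos θ := by
      rw [hn, hx]
      simp only [spherePt]
      simp [hr.ne']
    refine DifferentiableAt.comp (g := arccos) x ?_
      ((dn.inv (norm_ne_zero_iff.2 hx0)).mul (hcoord 2))
    rw [differentiableAt_arccos]
    change ‖x‖⁻¹ * x 2 ≠ -1 ∧ ‖x‖⁻¹ * x 2 ≠ 1
    rw [hv]
    constructor <;> intro h <;> nlinarith [sin_sq_add_cos_sq θ]
  have da : DifferentiableAt ℝ azimuthAngle x := by
    have hz : (x 0 + x 1 * Complex.I : ℂ) ∈ Complex.slitPlane := by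
      rw [Complex.mem_slitPlane_iff_arg]
      have h : Complex.arg (x 0 + x 1 * Complex.I) = φ := azimuthAngle_spherePt hr hθ hφ
      refine ⟨h ▸ hφ.2.ne, fun h0 => ?_⟩
      have hre := congrArg Complex.re h0
      have him := congrArg Complex.im h0
      have hs := (sin_pos_of_mem_Ioo hθ).ne'
      simp [hx, spherePt, hr.ne', hs,
        -Complex.ofReal_sin, -Complex.ofReal_cos] at hre him
      have := sin_sq_add_cos_sq φ
      simp [hre, him] at this
    have hlog := ((Complex.differentiableAt_log hz).restrictScalars ℝ).comp x
      (f := fun y : E3 => (y 0 + y 1 * Complex.I : ℂ))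
      (((Complex.ofRealCLM.differentiableAt).comp x (hcoord 0)).add
        (((Complex.ofRealCLM.differentiableAt).comp x (hcoord 1)).mul_const _))
    refine ((Complex.imCLM.differentiableAt).comp x hlog).congr_of_eventuallyEq
      (Filter.Eventually.of_forall fun y => ?_)
    simp [azimuthAngle, Complex.log_im]
  rw [← hn] at hR
  rw [← polarAngle_spherePt hr hθ φ] at hΘ
  rw [← azimuthAngle_spherePt hr hθ hφ] at hΦ
  exact ((hR.comp x dn).mul (hΘ.comp x dp)).mul (hΦ.comp x da)
/-! Gradients in spherical coordinates -/

/-- The unit vectors `e_r`, `e_θ`, `e_φ` resolve the inner product. -/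
lemma inner_eq_sum_spherical_frame (a b : E3) (θ φ : ℝ) :
    ⟪a, b⟫ = ⟪a, spherePt 1 θ φ⟫ * ⟪b, spherePt 1 θ φ⟫ +
      ⟪a, !₂[cos θ * cos φ, cos θ * sin φ, -sin θ]⟫ *
        ⟪b, !₂[cos θ * cos φ, cos θ * sin φ, -sin θ]⟫ +
      ⟪a, !₂[-sin φ, cos φ, 0]⟫ * ⟪b, !₂[-sin φ, cos φ, 0]⟫ := by
  simp only [PiLp.inner_apply, Fin.sum_univ_three, spherePt]
  simp
  have h1 := sin_sq_add_cos_sq θ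
  have h2 := sin_sq_add_cos_sq φ
  linear_combination -(a 0 * b 0 * cos φ ^ 2 + (a 0 * b 1 + a 1 * b 0) * (cos φ * sin φ) +
    a 1 * b 1 * sin φ ^ 2 + a 2 * b 2) * h1 - (a 0 * b 0 + a 1 * b 1) * h2

lemma hasDerivAt_of_coord {g : ℝ → E3} {g' : E3} {t : ℝ}
    (h : ∀ i, HasDerivAt (fun t => g t i) (g' i) t) : HasDerivAt g g' t := by
  have h2 : HasDerivAt (fun t => (g t).ofLp) g'.ofLp t := hasDerivAt_pi.2 h
  have h3 := (PiLp.hasFDerivAt_toLp 2 (𝕜 := ℝ) (g t).ofLp).comp_hasDerivAt t h2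
  exact h3

lemma hasDerivAt_spherePt_radius (r θ φ : ℝ) :
    HasDerivAt (fun r => spherePt r θ φ) (spherePt 1 θ φ) r := by
  refine hasDerivAt_of_coord fun i => ?_
  fin_cases i <;> simp [spherePt, mul_assoc] <;>
    simpa using (hasDerivAt_id r).mul_const _

lemma hasDerivAt_spherePt_polar (r θ φ : ℝ) :
    HasDerivAt (fun θ => spherePt r θ φ) (r • !₂[cos θ * cos φ, cos θ * sin φ, -sin θ]) θ := by
  refine hasDerivAt_of_coord fun i => ?_
  fin_cases i <;> simp [spherePt, mul_assoc]
  · exact ((hasDerivAt_sin θ).mul_const _).const_mul r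
  · exact ((hasDerivAt_sin θ).mul_const _).const_mul r
  · simpa using (hasDerivAt_cos θ).const_mul r

lemma hasDerivAt_spherePt_azimuth (r θ φ : ℝ) :
    HasDerivAt (fun φ => spherePt r θ φ) ((r * sin θ) • !₂[-sin φ, cos φ, 0]) φ := by
  refine hasDerivAt_of_coord fun i => ?_
  fin_cases i <;> simp [spherePt]
  · simpa using (hasDerivAt_cos φ).const_mul (r * sin θ)
  · simpa using (hasDerivAt_sin φ).const_mul (r * sin θ)
  · exact hasDerivAt_const _ _

lemma inner_gradient_separated {R Θ Φ : ℝ → ℝ} {r θ φ R' Θ' Φ' : ℝ} (hr : 0 < r)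
    (hθ : θ ∈ Set.Ioo 0 π) (hφ : φ ∈ Set.Ioo (-π) π) (hR : HasDerivAt R R' r)
    (hΘ : HasDerivAt Θ Θ' θ) (hΦ : HasDerivAt Φ Φ' φ) :
    ⟪gradient (separated R Θ Φ) (spherePt r θ φ), spherePt 1 θ φ⟫ = R' * Θ θ * Φ φ ∧
    ⟪gradient (separated R Θ Φ) (spherePt r θ φ),
      !₂[cos θ * cos φ, cos θ * sin φ, -sin θ]⟫ = R r * Θ' * Φ φ / r ∧
    ⟪gradient (separated R Θ Φ) (spherePt r θ φ), !₂[-sin φ, cos φ, 0]⟫ =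
      R r * Θ θ * Φ' / (r * sin θ) := by
  have hs := sin_pos_of_mem_Ioo hθ
  have hd := (differentiableAt_separated hr hθ hφ hR.differentiableAt hΘ.differentiableAt
    hΦ.differentiableAt).hasFDerivAt
  have h1 := hd.comp_hasDerivAt r (hasDerivAt_spherePt_radius r θ φ)
  have h2 := hd.comp_hasDerivAt θ (hasDerivAt_spherePt_polar r θ φ)
  have h3 := hd.comp_hasDerivAt φ (hasDerivAt_spherePt_azimuth r θ φ)
  have e1 := h1.unique (((hR.mul_const (Θ θ)).mul_const (Φ φ)).congr_of_eventuallyEq (by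
    filter_upwards [lt_mem_nhds hr] with s h using separated_spherePt R Θ Φ h hθ hφ))
  have e2 := h2.unique (((hΘ.const_mul (R r)).mul_const (Φ φ)).congr_of_eventuallyEq (by
    filter_upwards [isOpen_Ioo.mem_nhds hθ] with s h using separated_spherePt R Θ Φ hr h hφ))
  have e3 := h3.unique ((hΦ.const_mul (R r * Θ θ)).congr_of_eventuallyEq (by
    filter_upwards [isOpen_Ioo.mem_nhds hφ] with s h using separated_spherePt R Θ Φ hr hθ h))
  simp only [map_smul, smul_eq_mul] at e2 e3
  refine ⟨?_, ?_, ?_⟩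
  · rw [inner_gradient_left, e1]
  · rw [inner_gradient_left, eq_div_iff hr.ne', ← e2, mul_comm]
  · rw [inner_gradient_left, eq_div_iff (by positivity), ← e3, mul_comm]

lemma inner_gradient_separated_mul_jacobian {R Θ Φ R₂ Θ₂ Φ₂ : ℝ → ℝ}
    {r θ φ R' Θ' Φ' R₂' Θ₂' Φ₂' : ℝ} (hr : 0 < r)
    (hθ : θ ∈ Set.Ioo 0 π) (hφ : φ ∈ Set.Ioo (-π) π) (hR : HasDerivAt R R' r)
    (hΘ : HasDerivAt Θ Θ' θ) (hΦ : HasDerivAt Φ Φ' φ) (hR₂ : HasDerivAt R₂ R₂' r)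
    (hΘ₂ : HasDerivAt Θ₂ Θ₂' θ) (hΦ₂ : HasDerivAt Φ₂ Φ₂' φ) :
    r ^ 2 * sin θ * ⟪gradient (separated R Θ Φ) (spherePt r θ φ),
        gradient (separated R₂ Θ₂ Φ₂) (spherePt r θ φ)⟫ =
      r ^ 2 * (R' * R₂') * (sin θ * (Θ θ * Θ₂ θ)) * (Φ φ * Φ₂ φ) +
      R r * R₂ r * (sin θ * (Θ' * Θ₂')) * (Φ φ * Φ₂ φ) +
      R r * R₂ r * (Θ θ * Θ₂ θ / sin θ) * (Φ' * Φ₂') := by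
  have hs := sin_pos_of_mem_Ioo hθ
  obtain ⟨h1, h2, h3⟩ := inner_gradient_separated hr hθ hφ hR hΘ hΦ
  obtain ⟨h4, h5, h6⟩ := inner_gradient_separated hr hθ hφ hR₂ hΘ₂ hΦ₂
  rw [inner_eq_sum_spherical_frame _ _ θ φ, h1, h2, h3, h4, h5, h6]
  field_simp

/-! Integration in spherical coordinates -/

/-- The domain of the spherical coordinates of the unit ball. -/
def sphericalBox : Set (Fin 3 → ℝ) :=
  Set.univ.pi ![Set.Ioc 0 1, Set.Ioo 0 π, Set.Ioo (-π) π]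

lemma mem_sphericalBox {p : Fin 3 → ℝ} :
    p ∈ sphericalBox ↔ p 0 ∈ Set.Ioc (0 : ℝ) 1 ∧ p 1 ∈ Set.Ioo 0 π ∧ p 2 ∈ Set.Ioo (-π) π := by
  simp [sphericalBox, Set.mem_pi, Fin.forall_fin_succ]

lemma measurableSet_sphericalBox : MeasurableSet sphericalBox :=
  MeasurableSet.univ_pi fun i => by fin_cases i <;> simp

/-- The spherical coordinate map on coordinate triples. -/
noncomputable def sphericalMap (p : Fin 3 → ℝ) : Fin 3 → ℝ := (spherePt (p 0) (p 1) (p 2)).ofLp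

/-- The Jacobian matrix of `sphericalMap`. -/
noncomputable def sphericalJacobian (p : Fin 3 → ℝ) : Matrix (Fin 3) (Fin 3) ℝ :=
  !![sin (p 1) * cos (p 2), p 0 * cos (p 1) * cos (p 2), -(p 0 * sin (p 1) * sin (p 2));
     sin (p 1) * sin (p 2), p 0 * cos (p 1) * sin (p 2), p 0 * sin (p 1) * cos (p 2);
     cos (p 1), -(p 0 * sin (p 1)), 0]

lemma det_sphericalJacobian (p : Fin 3 → ℝ) :
    (LinearMap.toContinuousLinearMap (Matrix.toLin' (sphericalJacobian p))).det =
      p 0 ^ 2 * sin (p 1) := by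
  rw [LinearMap.det_toContinuousLinearMap, LinearMap.det_toLin', Matrix.det_fin_three]
  simp [sphericalJacobian]
  have h1 := sin_sq_add_cos_sq (p 1)
  have h2 := sin_sq_add_cos_sq (p 2)
  linear_combination (p 0 ^ 2 * sin (p 1) * (sin (p 1) ^ 2 + cos (p 1) ^ 2)) * h2 +
    p 0 ^ 2 * sin (p 1) * h1

lemma hasFDerivAt_sphericalMap (p : Fin 3 → ℝ) :
    HasFDerivAt sphericalMap
      (LinearMap.toContinuousLinearMap (Matrix.toLin' (sphericalJacobian p))) p := by
  have hc : ∀ i, HasFDerivAt (fun p : Fin 3 → ℝ => p i)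
      (ContinuousLinearMap.proj (R := ℝ) (φ := fun _ : Fin 3 => ℝ) i) p :=
    fun i => hasFDerivAt_apply i p
  rw [hasFDerivAt_pi']
  intro i
  fin_cases i
  · refine (((hc 0).mul (hc 1).sin).mul (hc 2).cos).congr_fderiv ?_
    ext v
    simp [sphericalJacobian, dotProduct, Fin.sum_univ_three]
    ring
  · refine (((hc 0).mul (hc 1).sin).mul (hc 2).sin).congr_fderiv ?_
    ext v
    simp [sphericalJacobian, dotProduct, Fin.sum_univ_three]
    ring
  · refine ((hc 0).mul (hc 1).cos).congr_fderiv ?_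
    ext v
    simp [sphericalJacobian, dotProduct, Fin.sum_univ_three]
    ring

lemma injOn_sphericalMap : Set.InjOn sphericalMap sphericalBox := by
  intro p hp q hq h
  have h' : spherePt (p 0) (p 1) (p 2) = spherePt (q 0) (q 1) (q 2) := PiLp.ext (congrFun h)
  obtain ⟨hp0, hp1, hp2⟩ := mem_sphericalBox.1 hp
  obtain ⟨hq0, hq1, hq2⟩ := mem_sphericalBox.1 hq
  ext i
  fin_cases i
  · simpa [norm_spherePt, hp0.1.le, hq0.1.le] using congrArg norm h'
  · simpa [polarAngle_spherePt, hp0.1, hq0.1, hp1, hq1] using congrArg polarAngle h'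
  · have := congrArg azimuthAngle h'
    rwa [azimuthAngle_spherePt hp0.1 hp1 hp2, azimuthAngle_spherePt hq0.1 hq1 hq2] at this

lemma ae_apply_one_ne_zero : ∀ᵐ x : Fin 3 → ℝ, x 1 ≠ 0 := by
  rw [ae_iff]
  simpa [volume_pi] using Measure.pi_hyperplane (fun _ : Fin 3 => (volume : Measure ℝ)) 1 0

lemma sphericalMap_image_ae_eq :
    sphericalMap '' sphericalBox =ᵐ[volume]
      (WithLp.toLp 2) ⁻¹' (Metric.closedBall (0 : E3) 1) := by
  filter_upwards [ae_apply_one_ne_zero] with x hx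
  apply propext
  constructor
  · rintro ⟨p, hp, rfl⟩
    obtain ⟨hp0, hp1, hp2⟩ := mem_sphericalBox.1 hp
    change spherePt (p 0) (p 1) (p 2) ∈ Metric.closedBall 0 1
    rw [mem_closedBall_zero_iff, norm_spherePt hp0.1.le]
    exact hp0.2
  · intro h
    have h1 : ‖(WithLp.toLp 2 x : E3)‖ ≤ 1 := mem_closedBall_zero_iff.1 h
    set y : E3 := WithLp.toLp 2 x with hy
    have hy1 : y 1 ≠ 0 := hx
    obtain ⟨ha, hb, hxy⟩ := spherePt_polarAngle_azimuthAngle hy1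
    refine ⟨![‖y‖, polarAngle y, azimuthAngle y], mem_sphericalBox.2 ⟨⟨?_, h1⟩, ha, hb⟩, ?_⟩
    · exact norm_pos_iff.2 (by intro h0; simp [h0] at hy1)
    · exact congrArg WithLp.ofLp hxy

lemma abs_det_sphericalJacobian {p : Fin 3 → ℝ} (hp : p ∈ sphericalBox) :
    |(LinearMap.toContinuousLinearMap (Matrix.toLin' (sphericalJacobian p))).det| =
      p 0 ^ 2 * sin (p 1) := by
  rw [det_sphericalJacobian]
  have := sin_pos_of_mem_Ioo (mem_sphericalBox.1 hp).2.1
  exact abs_of_nonneg (by positivity)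

lemma setIntegral_closedBall_eq (F : E3 → ℝ) :
    ∫ x in Metric.closedBall (0 : E3) 1, F x =
      ∫ p in sphericalBox, p 0 ^ 2 * sin (p 1) * F (spherePt (p 0) (p 1) (p 2)) := by
  have hmp := PiLp.volume_preserving_toLp (Fin 3)
  have hemb := (MeasurableEquiv.toLp 2 (Fin 3 → ℝ)).measurableEmbedding
  rw [← hmp.setIntegral_preimage_emb hemb, ← setIntegral_congr_set sphericalMap_image_ae_eq,
    integral_image_eq_integral_abs_det_fderiv_smul volume measurableSet_sphericalBox
      (fun p _ => (hasFDerivAt_sphericalMap p).hasFDerivWithinAt) injOn_sphericalMap]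
  refine setIntegral_congr_fun measurableSet_sphericalBox fun p hp => ?_
  simp only [abs_det_sphericalJacobian hp, smul_eq_mul]
  rfl

lemma integrableOn_closedBall_iff (F : E3 → ℝ) :
    IntegrableOn F (Metric.closedBall (0 : E3) 1) ↔
      IntegrableOn (fun p => p 0 ^ 2 * sin (p 1) * F (spherePt (p 0) (p 1) (p 2)))
        sphericalBox := by
  have hmp := PiLp.volume_preserving_toLp (Fin 3)
  have hemb := (MeasurableEquiv.toLp 2 (Fin 3 → ℝ)).measurableEmbedding
  rw [← hmp.integrableOn_comp_preimage hemb, ← integrableOn_congr_set_ae sphericalMap_image_ae_eq,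
    integrableOn_image_iff_integrableOn_abs_det_fderiv_smul volume measurableSet_sphericalBox
      (fun p _ => (hasFDerivAt_sphericalMap p).hasFDerivWithinAt) injOn_sphericalMap]
  refine integrableOn_congr_fun (fun p hp => ?_) measurableSet_sphericalBox
  simp only [abs_det_sphericalJacobian hp, smul_eq_mul]
  rfl

lemma integral_sphericalBox_mul {A B C : ℝ → ℝ} (hA : Continuous A) (hB : Continuous B)
    (hC : Continuous C) :
    IntegrableOn (fun p : Fin 3 → ℝ => A (p 0) * B (p 1) * C (p 2)) sphericalBox ∧
      ∫ p in sphericalBox, A (p 0) * B (p 1) * C (p 2) =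
        (∫ r in (0 : ℝ)..1, A r) * (∫ θ in (0 : ℝ)..π, B θ) * ∫ φ in (-π)..π, C φ := by
  have hs : ∀ i : Fin 3, SigmaFinite
      ((volume : Measure ℝ).restrict ((![Set.Ioc 0 1, Set.Ioo 0 π, Set.Ioo (-π) π] :
        Fin 3 → Set ℝ) i)) := fun i => inferInstance
  have hπ := Real.pi_pos
  have hprod : ∀ p : Fin 3 → ℝ, A (p 0) * B (p 1) * C (p 2) =
      ∏ i, (![A, B, C] : Fin 3 → ℝ → ℝ) i (p i) := fun p => by simp [Fin.prod_univ_three]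
  simp only [hprod]
  unfold IntegrableOn
  rw [sphericalBox, volume_pi, Measure.restrict_pi_pi]
  constructor
  · refine Integrable.fintype_prod fun i => ?_
    fin_cases i
    · exact hA.integrableOn_Ioc
    · exact (hB.integrableOn_Ioc).mono_set Set.Ioo_subset_Ioc_self
    · exact (hC.integrableOn_Ioc).mono_set Set.Ioo_subset_Ioc_self
  · rw [integral_fintype_prod_eq_prod, Fin.prod_univ_three, intervalIntegral.integral_of_le (by simp),
      intervalIntegral.integral_of_le hπ.le, intervalIntegral.integral_of_le (by linarith),
      integral_Ioc_eq_integral_Ioo (x := 0) (y := π), integral_Ioc_eq_integral_Ioo (x := -π)]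
    rfl

/-! Generalized ball polynomials in spherical coordinates -/

lemma ballB_zero_eq (k n l : ℕ) (x : E3) :
    ballB 0 k n l x = (jacobiPoly k 0 ((n : ℝ) + 1 / 2)).eval (‖x‖ ^ 2 - 1) * solidY n l x := by
  have hpos : 0 < poch ((n : ℝ) + k + 3 / 2) k := by
    unfold poch
    exact div_pos (Real.Gamma_pos_of_pos (by positivity)) (Real.Gamma_pos_of_pos (by positivity))
  rw [ballB, add_zero, div_self hpos.ne', one_mul, jacobiP_eq_eval]
  congr 3
  ring

lemma genBallB_eq_separated {k : ℕ} (hk : 1 ≤ k) (n l : ℕ) :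
    genBallB k n l = separated (radial k n)
      (fun θ => sphCoeff n l * polarFactor n (l / 2) θ) (azimuth l) := by
  ext x
  rw [genBallB, if_neg (by omega), ballB_zero_eq, ballB_zero_eq, solidY, sphY_eq, separated,
    radial, radialPoly, Polynomial.eval_sub]
  simp only [polarAngle, azimuthAngle]
  ring

lemma measurable_separated {R Θ Φ : ℝ → ℝ} (hR : Continuous R) (hΘ : Continuous Θ)
    (hΦ : Continuous Φ) : Measurable (separated R Θ Φ) := by
  have hc : ∀ i, Measurable (fun x : E3 => x i) := fun i => by fun_prop
  have hp : Measurable polarAngle :=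
    Real.measurable_arccos.comp (measurable_norm.inv.mul (hc 2))
  have ha : Measurable azimuthAngle :=
    Complex.measurable_arg.comp ((Complex.measurable_ofReal.comp (hc 0)).add
      ((Complex.measurable_ofReal.comp (hc 1)).mul_const _))
  exact ((hR.measurable.comp measurable_norm).mul (hΘ.measurable.comp hp)).mul
    (hΦ.measurable.comp ha)

lemma exists_bound_separated {R Θ Φ : ℝ → ℝ} (hR : Continuous R) (hΘ : Continuous Θ)
    (hΦ : Continuous Φ) :
    ∃ C, ∀ x ∈ Metric.closedBall (0 : E3) 1, ‖separated R Θ Φ x‖ ≤ C := by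
  obtain ⟨A, hA⟩ := (isCompact_Icc (a := (0 : ℝ)) (b := 1)).exists_bound_of_continuousOn
    hR.continuousOn
  obtain ⟨B, hB⟩ := (isCompact_Icc (a := (0 : ℝ)) (b := π)).exists_bound_of_continuousOn
    hΘ.continuousOn
  obtain ⟨C, hC⟩ := (isCompact_Icc (a := -π) (b := π)).exists_bound_of_continuousOn
    hΦ.continuousOn
  refine ⟨A * B * C, fun x hx => ?_⟩
  have h1 := hA ‖x‖ ⟨norm_nonneg _, mem_closedBall_zero_iff.1 hx⟩
  have h2 := hB (polarAngle x) ⟨arccos_nonneg _, arccos_le_pi _⟩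
  have h3 := hC (azimuthAngle x) ⟨(Complex.neg_pi_lt_arg _).le, Complex.arg_le_pi _⟩
  rw [separated, norm_mul, norm_mul]
  have hA0 := (norm_nonneg _).trans h1
  have hB0 := (norm_nonneg _).trans h2
  gcongr

lemma integrableOn_mul_genBallB {f : E3 → ℝ}
    (hf : IntegrableOn f (Metric.closedBall (0 : E3) 1) volume) {k : ℕ} (hk : 1 ≤ k) (n l : ℕ) :
    IntegrableOn (fun x => f x * genBallB k n l x) (Metric.closedBall (0 : E3) 1) := by
  have hR := continuous_radial k n
  have hΘ : Continuous (fun θ => sphCoeff n l * polarFactor n (l / 2) θ) :=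
    continuous_const.mul (continuous_polarFactor n (l / 2))
  have hΦ := continuous_azimuth l
  rw [genBallB_eq_separated hk]
  obtain ⟨C, hC⟩ := exists_bound_separated hR hΘ hΦ
  exact Integrable.mul_bdd hf (measurable_separated hR hΘ hΦ).aestronglyMeasurable
    (ae_restrict_of_forall_mem Metric.isClosed_closedBall.measurableSet hC)

lemma differentiableAt_genBallB {k : ℕ} (hk : 1 ≤ k) (n l : ℕ) {x : E3} (hx : x 1 ≠ 0) :
    DifferentiableAt ℝ (genBallB k n l) x := by
  obtain ⟨h1, h2, h3⟩ := spherePt_polarAngle_azimuthAngle hx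
  rw [genBallB_eq_separated hk, ← h3]
  exact differentiableAt_separated (norm_pos_iff.2 (by rintro rfl; simp at hx)) h1 h2
    (hasDerivAt_radial k n _).differentiableAt
    ((hasDerivAt_polarFactor n (l / 2) _).const_mul _).differentiableAt
    (hasDerivAt_azimuth l _).differentiableAt

/-- The polar factor of the azimuthal part of the gradient product. -/
noncomputable def polarFactorDivSin (n l n' l' : ℕ) (θ : ℝ) : ℝ :=
  sin θ ^ (l / 2 + l' / 2 - 1) *
    ((jacobiPoly (n - l / 2) (l / 2 : ℕ) (l / 2 : ℕ)).eval ((cos θ - 1) / 2) *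
      (jacobiPoly (n' - l' / 2) (l' / 2 : ℕ) (l' / 2 : ℕ)).eval ((cos θ - 1) / 2))

lemma continuous_polarFactorDivSin (n l n' l' : ℕ) :
    Continuous (polarFactorDivSin n l n' l') := by
  unfold polarFactorDivSin; fun_prop

lemma polarFactor_mul_div_sin (n l n' l' : ℕ) {θ : ℝ} (hθ : sin θ ≠ 0) (φ : ℝ) :
    polarFactor n (l / 2) θ * polarFactor n' (l' / 2) θ / sin θ *
        (azimuthDeriv l φ * azimuthDeriv l' φ) =
      polarFactorDivSin n l n' l' θ * (azimuthDeriv l φ * azimuthDeriv l' φ) := by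
  by_cases h : l / 2 = 0 ∨ l' / 2 = 0
  · have : azimuthDeriv l φ * azimuthDeriv l' φ = 0 := by
      rcases h with h | h <;> simp [azimuthDeriv, h]
    rw [this, mul_zero, mul_zero]
  · congr 1
    obtain ⟨m, hm⟩ : ∃ m, l / 2 + l' / 2 = m + 1 := ⟨l / 2 + l' / 2 - 1, by omega⟩
    have hp : sin θ ^ (l / 2) * sin θ ^ (l' / 2) = sin θ ^ m * sin θ := by
      rw [← pow_add, hm, pow_succ]
    rw [polarFactorDivSin, hm, Nat.add_sub_cancel, div_eq_iff hθ]
    unfold polarFactor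
    linear_combination ((jacobiPoly (n - l / 2) (l / 2 : ℕ) (l / 2 : ℕ)).eval ((cos θ - 1) / 2) *
      (jacobiPoly (n' - l' / 2) (l' / 2 : ℕ) (l' / 2 : ℕ)).eval ((cos θ - 1) / 2)) * hp

lemma jacobian_mul_inner_gradient_genBallB {k k' : ℕ} (hk : 1 ≤ k) (hk' : 1 ≤ k')
    (n l n' l' : ℕ) {p : Fin 3 → ℝ} (hp : p ∈ sphericalBox) :
    p 0 ^ 2 * sin (p 1) * ⟪gradient (genBallB k n l) (spherePt (p 0) (p 1) (p 2)),
        gradient (genBallB k' n' l') (spherePt (p 0) (p 1) (p 2))⟫ =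
      sphCoeff n l * sphCoeff n' l' *
      ((p 0 ^ 2 * (radialDeriv k n (p 0) * radialDeriv k' n' (p 0))) *
          (sin (p 1) * (polarFactor n (l / 2) (p 1) * polarFactor n' (l' / 2) (p 1))) *
          (azimuth l (p 2) * azimuth l' (p 2)) +
        (radial k n (p 0) * radial k' n' (p 0)) *
          (sin (p 1) * (polarFactorDeriv n (l / 2) (p 1) * polarFactorDeriv n' (l' / 2) (p 1))) *
          (azimuth l (p 2) * azimuth l' (p 2)) +
        (radial k n (p 0) * radial k' n' (p 0)) * polarFactorDivSin n l n' l' (p 1) *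
          (azimuthDeriv l (p 2) * azimuthDeriv l' (p 2))) := by
  obtain ⟨h0, h1, h2⟩ := mem_sphericalBox.1 hp
  rw [genBallB_eq_separated hk, genBallB_eq_separated hk',
    inner_gradient_separated_mul_jacobian h0.1 h1 h2 (hasDerivAt_radial k n _)
      ((hasDerivAt_polarFactor n (l / 2) _).const_mul _) (hasDerivAt_azimuth l _)
      (hasDerivAt_radial k' n' _) ((hasDerivAt_polarFactor n' (l' / 2) _).const_mul _)
      (hasDerivAt_azimuth l' _)]
  linear_combination (sphCoeff n l * sphCoeff n' l' * (radial k n (p 0) * radial k' n' (p 0))) *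
    polarFactor_mul_div_sin n l n' l' (sin_pos_of_mem_Ioo h1).ne' (p 2)

lemma integral_inner_gradient_genBallB {k k' n n' l l' : ℕ} (hk : 1 ≤ k) (hk' : 1 ≤ k')
    (hl : 1 ≤ l) (hl' : 1 ≤ l') (hln : l ≤ 2 * n + 1) (hln' : l' ≤ 2 * n' + 1) :
    IntegrableOn (fun x => ⟪gradient (genBallB k n l) x, gradient (genBallB k' n' l') x⟫)
        (Metric.closedBall (0 : E3) 1) ∧
      ∫ x in Metric.closedBall (0 : E3) 1,
        ⟪gradient (genBallB k n l) x, gradient (genBallB k' n' l') x⟫ =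
      if k = k' ∧ n = n' ∧ l = l' then 2 * (n : ℝ) + 4 * k + 1 else 0 := by
  have cR := (continuous_radial k n).mul (continuous_radial k' n')
  have cΦ := (continuous_azimuth l).mul (continuous_azimuth l')
  obtain ⟨i1, e1⟩ := integral_sphericalBox_mul
    ((continuous_id.pow 2).mul ((continuous_radialDeriv k n).mul (continuous_radialDeriv k' n')))
    (continuous_sin.mul
      ((continuous_polarFactor n (l / 2)).mul (continuous_polarFactor n' (l' / 2)))) cΦ
  obtain ⟨i2, e2⟩ := integral_sphericalBox_mul cR
    (continuous_sin.mul
      ((continuous_polarFactorDeriv n (l / 2)).mul (continuous_polarFactorDeriv n' (l' / 2)))) cΦ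
  obtain ⟨i3, e3⟩ := integral_sphericalBox_mul cR (continuous_polarFactorDivSin n l n' l')
    ((continuous_azimuthDeriv l).mul (continuous_azimuthDeriv l'))
  simp only [Pi.mul_apply, Pi.pow_apply, id] at i1 e1 i2 e2 i3 e3
  have hcongr := fun p hp =>
    jacobian_mul_inner_gradient_genBallB hk hk' n l n' l' (p := p) hp
  rw [integrableOn_closedBall_iff, setIntegral_closedBall_eq,
    integrableOn_congr_fun hcongr measurableSet_sphericalBox,
    setIntegral_congr_fun measurableSet_sphericalBox hcongr]
  refine ⟨((i1.add i2).add i3).const_mul _, ?_⟩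
  have e := integral_add (i1.add i2) i3
  simp only [Pi.add_apply] at e
  rw [integral_add i1 i2] at e
  rw [integral_const_mul, e, e1, e2, e3,
    integral_azimuth_mul_azimuth l l' hl hl', integral_azimuthDeriv_mul_azimuthDeriv l l' hl hl']
  by_cases hll : l = l'
  swap
  · simp [hll]
  subst hll
  have hP := integral_sin_mul_polarFactor n n' (l / 2) (by omega) (by omega)
  have hD := integral_polarFactorDeriv n n' (l / 2) (by omega) (by omega)
  have hq : ∫ θ in (0 : ℝ)..π, polarFactorDivSin n l n' l θ =
      ∫ θ in (0 : ℝ)..π, sin θ ^ (2 * (l / 2) - 1) *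
        ((jacobiPoly (n - l / 2) (l / 2 : ℕ) (l / 2 : ℕ)).eval ((cos θ - 1) / 2) *
          (jacobiPoly (n' - l / 2) (l / 2 : ℕ) (l / 2 : ℕ)).eval ((cos θ - 1) / 2)) := by
    unfold polarFactorDivSin
    rw [two_mul]
  rw [← hq] at hD
  rw [hP, if_pos rfl, if_pos rfl]
  set W : ℝ := if l = 1 then 2 * π else π with hW
  by_cases hnn : n = n'
  · subst hnn
    have hR := integral_radial k k' n hk hk'
    have hS := sphCoeff_sq_mul n l hl hln
    rw [← hW] at hS
    simp only [if_true, and_true] at hD ⊢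
    rw [← hR]
    linear_combination
      ((∫ r in (0 : ℝ)..1, r ^ 2 * (radialDeriv k n r * radialDeriv k' n r)) +
        (n * (n + 1) : ℝ) * (∫ r in (0 : ℝ)..1, radial k n r * radial k' n r)) * hS +
      (sphCoeff n l ^ 2 * W * ∫ r in (0 : ℝ)..1, radial k n r * radial k' n r) * hD
  · simp only [hnn, if_false, false_and, and_false] at hD ⊢
    linear_combination
      (sphCoeff n l * sphCoeff n' l * W * ∫ r in (0 : ℝ)..1, radial k n r * radial k' n' r) * hD

/-! The Galerkin problem -/

lemma ae_coord_one_ne_zero (s : Set E3) : ∀ᵐ x ∂(volume.restrict s), x 1 ≠ 0 :=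
  ae_restrict_of_ae ((PiLp.volume_preserving_ofLp (Fin 3)).quasiMeasurePreserving.ae
    ae_apply_one_ne_zero)

lemma inner_gradient_sum_mul {ι : Type*} {s : Finset ι} {a : ι → ℝ} {u : ι → E3 → ℝ} {x : E3}
    (h : ∀ i ∈ s, DifferentiableAt ℝ (u i) x) (y : E3) :
    ⟪gradient (fun x => ∑ i ∈ s, a i * u i x) x, y⟫ = ∑ i ∈ s, a i * ⟪gradient (u i) x, y⟫ := by
  simp only [inner_gradient_left]
  rw [fderiv_fun_sum fun i hi => (h i hi).const_mul (a i), _root_.sum_apply]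
  exact Finset.sum_congr rfl fun i hi => by rw [fderiv_const_mul (h i hi)]; rfl

lemma integral_inner_gradient_sum_mul {ι : Type*} {s : Finset ι} (a : ι → ℝ) {u : ι → E3 → ℝ}
    {v : E3 → ℝ} {B : Set E3} (h : ∀ i ∈ s, ∀ x : E3, x 1 ≠ 0 → DifferentiableAt ℝ (u i) x)
    (hi : ∀ i ∈ s, IntegrableOn (fun x => ⟪gradient (u i) x, gradient v x⟫) B) :
    IntegrableOn (fun x => ⟪gradient (fun x => ∑ i ∈ s, a i * u i x) x, gradient v x⟫) B ∧
      ∫ x in B, ⟪gradient (fun x => ∑ i ∈ s, a i * u i x) x, gradient v x⟫ =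
        ∑ i ∈ s, a i * ∫ x in B, ⟪gradient (u i) x, gradient v x⟫ := by
  have hae : (fun x => ⟪gradient (fun x => ∑ i ∈ s, a i * u i x) x, gradient v x⟫)
      =ᵐ[volume.restrict B] fun x => ∑ i ∈ s, a i * ⟪gradient (u i) x, gradient v x⟫ := by
    filter_upwards [ae_coord_one_ne_zero B] with x hx
    exact inner_gradient_sum_mul (fun i his => h i his x hx) _
  constructor
  · exact (integrable_finsetSum s fun i his => (hi i his).const_mul (a i)).congr hae.symm
  · rw [integral_congr_ae hae, integral_finsetSum s fun i his => (hi i his).const_mul (a i)]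
    exact Finset.sum_congr rfl fun i _ => integral_const_mul _ _

/-- The coefficients of `sigmaN`. -/
noncomputable def sigmaCoeff (f : E3 → ℝ) (N : ℕ) (i : Σ _ : ℕ, Σ _ : ℕ, ℕ) : ℝ :=
  if 2 * i.1 + i.2.1 ≤ N then
    (2 * (i.2.1 : ℝ) + 4 * i.1 + 1)⁻¹ *
      ∫ y in Metric.closedBall (0 : E3) 1, f y * genBallB i.1 i.2.1 i.2.2 y
  else 0

/-- The index set of `sigmaN`. -/
def sigmaIndex (N : ℕ) : Finset (Σ _ : ℕ, Σ _ : ℕ, ℕ) :=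
  (Finset.Icc 1 N).sigma fun _ => (Finset.range (N + 1)).sigma fun n => Finset.Icc 1 (2 * n + 1)

lemma mem_sigmaIndex {N : ℕ} {i : Σ _ : ℕ, Σ _ : ℕ, ℕ} :
    i ∈ sigmaIndex N ↔ (1 ≤ i.1 ∧ i.1 ≤ N) ∧ i.2.1 < N + 1 ∧ 1 ≤ i.2.2 ∧
      i.2.2 ≤ 2 * i.2.1 + 1 := by
  simp [sigmaIndex]

lemma sigmaN_eq_sum (f : E3 → ℝ) (N : ℕ) :
    sigmaN f N = fun x =>
      ∑ i ∈ sigmaIndex N, sigmaCoeff f N i * genBallB i.1 i.2.1 i.2.2 x := by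
  ext x
  simp only [sigmaN, sigmaIndex, Finset.sum_sigma, sigmaCoeff, ite_mul, zero_mul]

lemma integral_inner_gradient_sigmaN_genBallB (f : E3 → ℝ) {N k n l : ℕ} (hk : 1 ≤ k)
    (hN : 2 * k + n ≤ N) (hl : 1 ≤ l) (hln : l ≤ 2 * n + 1) :
    IntegrableOn (fun x => ⟪gradient (sigmaN f N) x, gradient (genBallB k n l) x⟫)
        (Metric.closedBall (0 : E3) 1) ∧
      ∫ x in Metric.closedBall (0 : E3) 1,
        ⟪gradient (sigmaN f N) x, gradient (genBallB k n l) x⟫ =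
      ∫ x in Metric.closedBall (0 : E3) 1, f x * genBallB k n l x := by
  have horth := fun i (hi : i ∈ sigmaIndex N) =>
    integral_inner_gradient_genBallB (mem_sigmaIndex.1 hi).1.1 hk (mem_sigmaIndex.1 hi).2.2.1 hl
      (mem_sigmaIndex.1 hi).2.2.2 hln
  rw [sigmaN_eq_sum]
  obtain ⟨h1, h2⟩ := integral_inner_gradient_sum_mul (sigmaCoeff f N)
    (u := fun i : Σ _ : ℕ, Σ _ : ℕ, ℕ => genBallB i.1 i.2.1 i.2.2)
    (fun i hi x hx => differentiableAt_genBallB (mem_sigmaIndex.1 hi).1.1 _ _ hx)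
    (fun i hi => (horth i hi).1)
  refine ⟨h1, ?_⟩
  have hmem : (⟨k, n, l⟩ : Σ _ : ℕ, Σ _ : ℕ, ℕ) ∈ sigmaIndex N :=
    mem_sigmaIndex.2 ⟨⟨hk, by dsimp only; omega⟩, by dsimp only; omega, hl, hln⟩
  rw [h2, Finset.sum_eq_single_of_mem _ hmem, (horth _ hmem).2, if_pos ⟨rfl, rfl, rfl⟩,
    sigmaCoeff, if_pos hN]
  · have : (2 * (n : ℝ) + 4 * k + 1) ≠ 0 := by positivity
    field_simp
  · rintro ⟨k', n', l'⟩ hi hne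
    rw [(horth _ hi).2, if_neg, mul_zero]
    rintro ⟨rfl, rfl, rfl⟩
    exact hne rfl

/-- `σ_N` solves the discrete Galerkin problem
`∫_{B³} ∇σ_N · ∇v_N dx = ∫_{B³} f v_N dx` for all `v_N ∈ V_N`. -/
theorem sigmaN_solves_discrete_problem (f : E3 → ℝ)
    (hf : IntegrableOn f (Metric.closedBall (0 : E3) 1) volume) (N : ℕ) (hN : 2 ≤ N) :
    ∀ vN ∈ VN N,
      (∫ x in Metric.closedBall (0 : E3) 1, ⟪gradient (sigmaN f N) x, gradient vN x⟫) =
        ∫ x in Metric.closedBall (0 : E3) 1, f x * vN x := by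
  intro vN hvN
  suffices h : (∀ x : E3, x 1 ≠ 0 → DifferentiableAt ℝ vN x) ∧
      IntegrableOn (fun x => f x * vN x) (Metric.closedBall (0 : E3) 1) ∧
      IntegrableOn (fun x => ⟪gradient (sigmaN f N) x, gradient vN x⟫)
        (Metric.closedBall (0 : E3) 1) ∧
      (∫ x in Metric.closedBall (0 : E3) 1, ⟪gradient (sigmaN f N) x, gradient vN x⟫) =
        ∫ x in Metric.closedBall (0 : E3) 1, f x * vN x from h.2.2.2
  induction hvN using Submodule.span_induction with
  | mem v hv =>
    obtain ⟨k, n, l, hk, -, hkN, hl, hln, rfl⟩ := hv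
    exact ⟨fun x hx => differentiableAt_genBallB hk n l hx, integrableOn_mul_genBallB hf hk n l,
      integral_inner_gradient_sigmaN_genBallB f hk hkN hl hln⟩
  | zero =>
    have hg : ∀ x, gradient (0 : E3 → ℝ) x = 0 := fun x => gradient_const x 0
    simp [hg]
  | add u v _ _ hu hv =>
    obtain ⟨du, fu, iu, eu⟩ := hu
    obtain ⟨dv, fv, iv, ev⟩ := hv
    have hae : (fun x => ⟪gradient (sigmaN f N) x, gradient (u + v) x⟫)
        =ᵐ[volume.restrict (Metric.closedBall 0 1)] fun x =>
          ⟪gradient (sigmaN f N) x, gradient u x⟫ + ⟪gradient (sigmaN f N) x, gradient v x⟫ := by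
      filter_upwards [ae_coord_one_ne_zero _] with x hx
      simp only [real_inner_comm _ (gradient (sigmaN f N) x), inner_gradient_left]
      rw [fderiv_add (du x hx) (dv x hx)]
      rfl
    simp only [Pi.add_apply, mul_add]
    refine ⟨fun x hx => (du x hx).add (dv x hx), fu.add fv, (iu.add iv).congr hae.symm, ?_⟩
    rw [integral_congr_ae hae, integral_add iu iv, integral_add fu fv, eu, ev]
  | smul c v _ hv =>
    obtain ⟨dv, fv, iv, ev⟩ := hv
    have hae : (fun x => ⟪gradient (sigmaN f N) x, gradient (c • v) x⟫)
        =ᵐ[volume.restrict (Metric.closedBall 0 1)] fun x =>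
          c * ⟪gradient (sigmaN f N) x, gradient v x⟫ := by
      filter_upwards [ae_coord_one_ne_zero _] with x hx
      simp only [real_inner_comm _ (gradient (sigmaN f N) x), inner_gradient_left]
      rw [fderiv_const_smul (dv x hx)]
      rfl
    simp only [Pi.smul_apply, smul_eq_mul, mul_left_comm _ c]
    refine ⟨fun x hx => (dv x hx).const_smul c, fv.const_mul c, (iv.const_mul c).congr hae.symm, ?_⟩
    rw [integral_congr_ae hae, integral_const_mul, integral_const_mul, ev]
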